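/- arXiv:2101.09024 — 3 statements merged into one kernel-verified Lean document; each statement's English description precedes it below -/
import Mathlib

section
/- There exist a constant C > 0 and a valid online translation strategy σ such that for every nonempty finite stream L consisting of n pieces, ALG_σ(L) ≤ C·√n·OPT(L), where the cost is the area of the bounding box. (An O(√n)-competitive online algorithm for area minimization with translations only.) -/
open Set

/-- A piece is a pair (w,h) of (intended positive) real numbers. -/
abbrev Piece := ℝ × ℝ

/-- Both edge lengths of the piece are positive. -/
def PiecePos (p : Piece) : Prop := 0 < p.1 ∧ 0 < p.2

/-- The axis-parallel closed rectangle obtained by placing piece `p` by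
translation at the point `q`. -/
def placedRect (p : Piece) (q : ℝ × ℝ) : Set (ℝ × ℝ) :=
  Set.Icc q.1 (q.1 + p.1) ×ˢ Set.Icc q.2 (q.2 + p.2)

/-- Width of the axis-parallel bounding box of a set in the plane. -/
noncomputable def boxWidth (S : Set (ℝ × ℝ)) : ℝ :=
  sSup (Prod.fst '' S) - sInf (Prod.fst '' S)

/-- Height of the axis-parallel bounding box of a set in the plane. -/
noncomputable def boxHeight (S : Set (ℝ × ℝ)) : ℝ :=
  sSup (Prod.snd '' S) - sInf (Prod.snd '' S)

/-! ### Translations only -/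

/-- `pos` is a packing (by translations) of the list `L` of pieces:
the placed rectangles have pairwise disjoint interiors. -/
def IsPacking (L : List Piece) (pos : Fin L.length → ℝ × ℝ) : Prop :=
  ∀ i j : Fin L.length, i ≠ j →
    Disjoint (interior (placedRect (L.get i) (pos i)))
             (interior (placedRect (L.get j) (pos j)))

/-- The union of the placed rectangles. -/
def packedSet (L : List Piece) (pos : Fin L.length → ℝ × ℝ) : Set (ℝ × ℝ) :=
  ⋃ i : Fin L.length, placedRect (L.get i) (pos i)

/-- Perimeter of the bounding box of a packing. -/
noncomputable def periCost (L : List Piece) (pos : Fin L.length → ℝ × ℝ) : ℝ :=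
  2 * (boxWidth (packedSet L pos) + boxHeight (packedSet L pos))

/-- Area of the bounding box of a packing. -/
noncomputable def areaCost (L : List Piece) (pos : Fin L.length → ℝ × ℝ) : ℝ :=
  boxWidth (packedSet L pos) * boxHeight (packedSet L pos)

/-- Optimal offline bounding-box perimeter for the pieces of `L`. -/
noncomputable def optPeri (L : List Piece) : ℝ :=
  sInf { c | ∃ pos : Fin L.length → ℝ × ℝ, IsPacking L pos ∧ periCost L pos = c }

/-- Optimal offline bounding-box area for the pieces of `L`. -/
noncomputable def optArea (L : List Piece) : ℝ :=
  sInf { c | ∃ pos : Fin L.length → ℝ × ℝ, IsPacking L pos ∧ areaCost L pos = c }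

/-- The positions chosen by the online strategy `σ` on the stream `L`:
the `i`-th piece is placed at the point chosen by `σ` as a function of the
first `i+1` pieces. -/
def onlinePos (σ : List Piece → ℝ × ℝ) (L : List Piece) :
    Fin L.length → ℝ × ℝ :=
  fun i => σ (L.take ((i : ℕ) + 1))

/-- `σ` is a valid online translation strategy: on every stream of pieces it
produces a packing. -/
def StrategyValid (σ : List Piece → ℝ × ℝ) : Prop :=
  ∀ L : List Piece, (∀ p ∈ L, PiecePos p) → IsPacking L (onlinePos σ L)

/-- Perimeter of the bounding box of the packing produced by `σ` on `L`. -/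
noncomputable def algPeri (σ : List Piece → ℝ × ℝ) (L : List Piece) : ℝ :=
  periCost L (onlinePos σ L)

/-- Area of the bounding box of the packing produced by `σ` on `L`. -/
noncomputable def algArea (σ : List Piece → ℝ × ℝ) (L : List Piece) : ℝ :=
  areaCost L (onlinePos σ L)

/-! ### Rotations by 90° allowed -/

/-- The piece `p` in the orientation given by `r`: rotated by 90° if `r` is
`true`. -/
def orient (p : Piece) (r : Bool) : Piece := if r then (p.2, p.1) else p

/-- `pos, rot` is a packing with rotations of the list `L` of pieces. -/
def IsRotPacking (L : List Piece) (pos : Fin L.length → ℝ × ℝ)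
    (rot : Fin L.length → Bool) : Prop :=
  ∀ i j : Fin L.length, i ≠ j →
    Disjoint (interior (placedRect (orient (L.get i) (rot i)) (pos i)))
             (interior (placedRect (orient (L.get j) (rot j)) (pos j)))

/-- The union of the placed (possibly rotated) rectangles. -/
def packedRotSet (L : List Piece) (pos : Fin L.length → ℝ × ℝ)
    (rot : Fin L.length → Bool) : Set (ℝ × ℝ) :=
  ⋃ i : Fin L.length, placedRect (orient (L.get i) (rot i)) (pos i)

/-- Perimeter of the bounding box of a packing with rotations. -/
noncomputable def periRotCost (L : List Piece) (pos : Fin L.length → ℝ × ℝ)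
    (rot : Fin L.length → Bool) : ℝ :=
  2 * (boxWidth (packedRotSet L pos rot) + boxHeight (packedRotSet L pos rot))

/-- Area of the bounding box of a packing with rotations. -/
noncomputable def areaRotCost (L : List Piece) (pos : Fin L.length → ℝ × ℝ)
    (rot : Fin L.length → Bool) : ℝ :=
  boxWidth (packedRotSet L pos rot) * boxHeight (packedRotSet L pos rot)

/-- Optimal offline bounding-box perimeter with rotations allowed. -/
noncomputable def optRotPeri (L : List Piece) : ℝ :=
  sInf { c | ∃ (pos : Fin L.length → ℝ × ℝ) (rot : Fin L.length → Bool),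
    IsRotPacking L pos rot ∧ periRotCost L pos rot = c }

/-- Optimal offline bounding-box area with rotations allowed. -/
noncomputable def optRotArea (L : List Piece) : ℝ :=
  sInf { c | ∃ (pos : Fin L.length → ℝ × ℝ) (rot : Fin L.length → Bool),
    IsRotPacking L pos rot ∧ areaRotCost L pos rot = c }

/-- The positions chosen by the online rotation strategy `σ` on the stream `L`. -/
def onlineRotPos (σ : List Piece → (ℝ × ℝ) × Bool) (L : List Piece) :
    Fin L.length → ℝ × ℝ :=
  fun i => (σ (L.take ((i : ℕ) + 1))).1

/-- The orientations chosen by the online rotation strategy `σ` on the stream `L`. -/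
def onlineRot (σ : List Piece → (ℝ × ℝ) × Bool) (L : List Piece) :
    Fin L.length → Bool :=
  fun i => (σ (L.take ((i : ℕ) + 1))).2

/-- `σ` is a valid online rotation strategy: on every stream of pieces it
produces a packing with rotations. -/
def RotStrategyValid (σ : List Piece → (ℝ × ℝ) × Bool) : Prop :=
  ∀ L : List Piece, (∀ p ∈ L, PiecePos p) →
    IsRotPacking L (onlineRotPos σ L) (onlineRot σ L)

/-- Perimeter of the bounding box of the packing produced by `σ` on `L`. -/
noncomputable def algRotPeri (σ : List Piece → (ℝ × ℝ) × Bool) (L : List Piece) : ℝ :=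
  periRotCost L (onlineRotPos σ L) (onlineRot σ L)

/-- Area of the bounding box of the packing produced by `σ` on `L`. -/
noncomputable def algRotArea (σ : List Piece → (ℝ × ℝ) × Bool) (L : List Piece) : ℝ :=
  areaRotCost L (onlineRotPos σ L) (onlineRot σ L)

/-! ### Square pieces, bounding-square cost -/

/-- The axis-parallel closed square of side `s` placed at the point `q`. -/
def placedSq (s : ℝ) (q : ℝ × ℝ) : Set (ℝ × ℝ) :=
  Set.Icc q.1 (q.1 + s) ×ˢ Set.Icc q.2 (q.2 + s)

/-- `pos` is a packing of the list `L` of square pieces. -/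
def IsSqPacking (L : List ℝ) (pos : Fin L.length → ℝ × ℝ) : Prop :=
  ∀ i j : Fin L.length, i ≠ j →
    Disjoint (interior (placedSq (L.get i) (pos i)))
             (interior (placedSq (L.get j) (pos j)))

/-- The union of the placed squares. -/
def packedSqSet (L : List ℝ) (pos : Fin L.length → ℝ × ℝ) : Set (ℝ × ℝ) :=
  ⋃ i : Fin L.length, placedSq (L.get i) (pos i)

/-- Area of the smallest axis-parallel square containing all placed squares. -/
noncomputable def sqCost (L : List ℝ) (pos : Fin L.length → ℝ × ℝ) : ℝ :=
  (max (boxWidth (packedSqSet L pos)) (boxHeight (packedSqSet L pos))) ^ 2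

/-- Optimal offline bounding-square area for the square pieces of `L`. -/
noncomputable def optSq (L : List ℝ) : ℝ :=
  sInf { c | ∃ pos : Fin L.length → ℝ × ℝ, IsSqPacking L pos ∧ sqCost L pos = c }

/-- The positions chosen by the online strategy `σ` on the stream `L` of
square pieces. -/
def onlineSqPos (σ : List ℝ → ℝ × ℝ) (L : List ℝ) : Fin L.length → ℝ × ℝ :=
  fun i => σ (L.take ((i : ℕ) + 1))

/-- `σ` is a valid online translation strategy for square pieces. -/
def SqStrategyValid (σ : List ℝ → ℝ × ℝ) : Prop :=
  ∀ L : List ℝ, (∀ s ∈ L, 0 < s) → IsSqPacking L (onlineSqPos σ L)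

/-- Bounding-square area of the packing produced by `σ` on `L`. -/
noncomputable def algSq (σ : List ℝ → ℝ × ℝ) (L : List ℝ) : ℝ :=
  sqCost L (onlineSqPos σ L)

/-- A placed piece: the piece together with its lower left corner. -/
abbrev PlacedPiece := Piece × (ℝ × ℝ)

/-- Two placed pieces are separated by an axis-parallel line. -/
def Separated (r s : PlacedPiece) : Prop :=
  r.2.1 + r.1.1 ≤ s.2.1 ∨ s.2.1 + s.1.1 ≤ r.2.1 ∨
    r.2.2 + r.1.2 ≤ s.2.2 ∨ s.2.2 + s.1.2 ≤ r.2.2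

lemma Separated.symm {r s : PlacedPiece} (h : Separated r s) : Separated s r := by
  unfold Separated at *
  tauto

lemma interior_placedRect (p : Piece) (q : ℝ × ℝ) :
    interior (placedRect p q) =
      Set.Ioo q.1 (q.1 + p.1) ×ˢ Set.Ioo q.2 (q.2 + p.2) := by
  rw [placedRect, interior_prod_eq, interior_Icc, interior_Icc]

lemma Separated.disjoint_interior {r s : PlacedPiece} (h : Separated r s) :
    Disjoint (interior (placedRect r.1 r.2)) (interior (placedRect s.1 s.2)) := by
  rw [interior_placedRect, interior_placedRect, Set.disjoint_left]
  rintro ⟨x, y⟩ ⟨⟨h1, h2⟩, h3, h4⟩ ⟨⟨h5, h6⟩, h7, h8⟩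
  simp only at *
  rcases h with h | h | h | h <;> linarith

/-! ### The shelf heights -/

/-- The exponent of the smallest power of two that is at least `h`. -/
noncomputable def shelfClass (h : ℝ) : ℤ := Int.clog 2 h

lemma le_shelfHeight (h : ℝ) : h ≤ (2 : ℝ) ^ shelfClass h := by
  exact_mod_cast Int.self_le_zpow_clog (b := 2) (by norm_num) h

lemma shelfHeight_le {h : ℝ} (hh : 0 < h) : (2 : ℝ) ^ shelfClass h ≤ 2 * h := by
  have h1 : (2 : ℝ) ^ (shelfClass h - 1) < h := by
    exact_mod_cast Int.zpow_pred_clog_lt_self (b := 2) (by norm_num) hh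
  rw [zpow_sub_one₀ (by norm_num)] at h1
  linarith

lemma sum_two_zpow_le (F : Finset ℤ) :
    ∀ m : ℤ, (∀ j ∈ F, j ≤ m) → ∑ j ∈ F, (2 : ℝ) ^ j ≤ 2 * 2 ^ m := by
  induction F using Finset.induction_on_max with
  | empty => intro m _; simp; positivity
  | insert a s hs ih =>
    intro m hm
    rw [Finset.sum_insert fun h => lt_irrefl _ (hs a h)]
    have h1 := ih (a - 1) fun j hj => by have := hs j hj; omega
    rw [zpow_sub_one₀ (by norm_num)] at h1
    have h2 : (2 : ℝ) ^ a ≤ 2 ^ m :=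
      zpow_le_zpow_right₀ (by norm_num) (hm a (Finset.mem_insert_self a s))
    linarith

lemma sum_two_zpow_le_of_forall_le {F : Finset ℤ} {c : ℝ} (hc : 0 ≤ c)
    (h : ∀ j ∈ F, (2 : ℝ) ^ j ≤ c) : ∑ j ∈ F, (2 : ℝ) ^ j ≤ 2 * c := by
  rcases F.eq_empty_or_nonempty with rfl | hF
  · simpa using hc
  · have h1 := sum_two_zpow_le F (F.max' hF) fun j hj => F.le_max' j hj
    have h2 := h _ (F.max'_mem hF)
    linarith

/-! ### The algorithm -/

/-- The state of the online algorithm. Pieces go into shelves, whose heights are powers of two,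
inside the box `[left, left + width] × [0, ∞)`; all earlier boxes lie to its left. -/
structure ShelfState where
  /-- number of pieces -/
  count : ℕ
  /-- largest width -/
  maxW : ℝ
  /-- largest height -/
  maxH : ℝ
  /-- total area of the pieces -/
  area : ℝ
  /-- left edge of the current box -/
  left : ℝ
  /-- width of the current box -/
  width : ℝ
  /-- total height of the shelves in the current box -/
  top : ℝ
  /-- largest height reached in any box -/
  ceil : ℝ
  /-- classes with an open shelf -/
  shelves : Finset ℤ
  /-- used width of the open shelf of each class -/
  used : ℤ → ℝ
  /-- bottom of the open shelf of each class -/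
  base : ℤ → ℝ
  /-- position of the last piece -/
  pos : ℝ × ℝ
  /-- all placed pieces -/
  rects : Set PlacedPiece

namespace ShelfState

/-- The state before the first piece. -/
noncomputable def init : ShelfState where
  count := 0
  maxW := 0
  maxH := 0
  area := 0
  left := 0
  width := 0
  top := 0
  ceil := 0
  shelves := ∅
  used := fun _ => 0
  base := fun _ => 0
  pos := 0
  rects := ∅

/-- Update the statistics of the stream. -/
noncomputable def tally (s : ShelfState) (p : Piece) : ShelfState :=
  { s with
    count := s.count + 1
    maxW := max s.maxW p.1
    maxH := max s.maxH p.2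
    area := s.area + p.1 * p.2 }

/-- Open a new box, to the right of the current one and at least twice as wide. -/
noncomputable def widen (s : ShelfState) (p : Piece) : ShelfState :=
  { s with
    left := s.left + s.width
    width := 2 * max p.1 s.width
    top := 0
    shelves := ∅ }

/-- Put the piece into the open shelf of its class. -/
noncomputable def reuse (s : ShelfState) (p : Piece) : ShelfState :=
  let j := shelfClass p.2
  { s with
    used := Function.update s.used j (s.used j + p.1)
    pos := (s.left + s.used j, s.base j)
    rects := insert (p, (s.left + s.used j, s.base j)) s.rects }

/-- Open a new shelf on top of the others and put the piece there. -/
noncomputable def fresh (s : ShelfState) (p : Piece) : ShelfState :=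
  let j := shelfClass p.2
  { s with
    top := s.top + 2 ^ j
    ceil := max s.ceil (s.top + 2 ^ j)
    shelves := insert j s.shelves
    used := Function.update s.used j p.1
    base := Function.update s.base j s.top
    pos := (s.left, s.top)
    rects := insert (p, (s.left, s.top)) s.rects }

/-- The piece fits into the open shelf of its class. -/
def Fits (s : ShelfState) (p : Piece) : Prop :=
  shelfClass p.2 ∈ s.shelves ∧ s.used (shelfClass p.2) + p.1 ≤ s.width

open Classical in
/-- Place the piece into the current box. -/
noncomputable def place (s : ShelfState) (p : Piece) : ShelfState :=
  if s.Fits p then s.reuse p else s.fresh p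

/-- The piece can be placed into the current box without making it too high. -/
def Acceptable (s : ShelfState) (p : Piece) : Prop :=
  p.1 ≤ s.width ∧ (s.place p).top ≤ 8 * s.maxH * Real.sqrt s.count

open Classical in
/-- Process a piece. -/
noncomputable def step (s : ShelfState) (p : Piece) : ShelfState :=
  if (s.tally p).Acceptable p then (s.tally p).place p else ((s.tally p).widen p).place p

/-! ### Geometric invariants -/

/-- The placed pieces avoid the free parts of the current box. -/
structure Geometric (s : ShelfState) : Prop where
  left_nonneg : 0 ≤ s.left
  width_nonneg : 0 ≤ s.width
  top_nonneg : 0 ≤ s.top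
  top_le_ceil : s.top ≤ s.ceil
  nonneg : ∀ r ∈ s.rects, 0 ≤ r.2.1 ∧ 0 ≤ r.2.2
  le_right : ∀ r ∈ s.rects, r.2.1 + r.1.1 ≤ s.left + s.width
  le_ceil : ∀ r ∈ s.rects, r.2.2 + r.1.2 ≤ s.ceil
  below_top : ∀ r ∈ s.rects, r.2.1 + r.1.1 ≤ s.left ∨ r.2.2 + r.1.2 ≤ s.top
  free : ∀ j ∈ s.shelves, ∀ r ∈ s.rects, r.2.1 + r.1.1 ≤ s.left + s.used j ∨
    r.2.2 + r.1.2 ≤ s.base j ∨ s.base j + 2 ^ j ≤ r.2.2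
  used_nonneg : ∀ j ∈ s.shelves, 0 ≤ s.used j
  base_nonneg : ∀ j ∈ s.shelves, 0 ≤ s.base j
  shelf_le_top : ∀ j ∈ s.shelves, s.base j + 2 ^ j ≤ s.top
  shelves_separated : ∀ i ∈ s.shelves, ∀ j ∈ s.shelves, i ≠ j →
    s.base i + 2 ^ i ≤ s.base j ∨ s.base j + 2 ^ j ≤ s.base i

variable {s : ShelfState} {p : Piece}

lemma Geometric.init : init.Geometric := by
  constructor <;> simp [ShelfState.init]

lemma Geometric.tally (h : s.Geometric) : (s.tally p).Geometric := by
  obtain ⟨⟩ := h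
  constructor <;> assumption

lemma Geometric.widen (h : s.Geometric) : (s.widen p).Geometric where
  left_nonneg := add_nonneg h.left_nonneg h.width_nonneg
  width_nonneg := mul_nonneg zero_le_two (h.width_nonneg.trans (le_max_right _ _))
  top_nonneg := le_rfl
  top_le_ceil := h.top_nonneg.trans h.top_le_ceil
  nonneg := h.nonneg
  le_right r hr := by
    have h1 := h.le_right r hr
    have h2 : 0 ≤ max p.1 s.width := h.width_nonneg.trans (le_max_right _ _)
    simp only [ShelfState.widen]
    linarith
  le_ceil := h.le_ceil
  below_top r hr := Or.inl (h.le_right r hr)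
  free := by simp [ShelfState.widen]
  used_nonneg := by simp [ShelfState.widen]
  base_nonneg := by simp [ShelfState.widen]
  shelf_le_top := by simp [ShelfState.widen]
  shelves_separated := by simp [ShelfState.widen]

lemma Geometric.reuse (h : s.Geometric) (hp : PiecePos p) (hf : s.Fits p) :
    (s.reuse p).Geometric := by
  obtain ⟨hj, hu⟩ := hf
  have hh := le_shelfHeight p.2
  have hw := hp.1
  have hl := h.left_nonneg
  have hu0 := h.used_nonneg _ hj
  have hb0 := h.base_nonneg _ hj
  have ht := h.shelf_le_top _ hj
  have hc := h.top_le_ceil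
  constructor <;> simp only [ShelfState.reuse, Set.mem_insert_iff, forall_eq_or_imp]
  · exact h.left_nonneg
  · exact h.width_nonneg
  · exact h.top_nonneg
  · exact h.top_le_ceil
  · exact ⟨⟨by linarith, hb0⟩, h.nonneg⟩
  · exact ⟨by linarith, h.le_right⟩
  · exact ⟨by linarith, h.le_ceil⟩
  · exact ⟨Or.inr (by linarith), h.below_top⟩
  · intro i hi
    by_cases hij : i = shelfClass p.2
    · subst hij
      simp only [Function.update_self]
      refine ⟨Or.inl (by linarith), fun r hr => ?_⟩
      rcases h.free _ hi r hr with h1 | h1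
      · exact Or.inl (by linarith)
      · exact Or.inr h1
    · simp only [Function.update_of_ne hij]
      refine ⟨Or.inr ?_, h.free i hi⟩
      rcases h.shelves_separated i hi _ hj hij with h1 | h1
      · exact Or.inr h1
      · exact Or.inl (by linarith)
  · intro i hi
    by_cases hij : i = shelfClass p.2
    · subst hij
      simp only [Function.update_self]
      linarith
    · simpa only [Function.update_of_ne hij] using h.used_nonneg i hi
  · exact h.base_nonneg
  · exact h.shelf_le_top
  · exact h.shelves_separated

lemma Geometric.fresh (h : s.Geometric) (hp : PiecePos p) (hw : p.1 ≤ s.width) :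
    (s.fresh p).Geometric := by
  have hh := le_shelfHeight p.2
  have hw0 := hp.1
  have hh0 := hp.2
  have hl := h.left_nonneg
  have ht0 := h.top_nonneg
  have hc := h.top_le_ceil
  have hc1 : s.ceil ≤ max s.ceil (s.top + 2 ^ shelfClass p.2) := le_max_left _ _
  have hc2 : s.top + 2 ^ shelfClass p.2 ≤ max s.ceil (s.top + 2 ^ shelfClass p.2) :=
    le_max_right _ _
  have hmem : ∀ i ∈ insert (shelfClass p.2) s.shelves, i ≠ shelfClass p.2 → i ∈ s.shelves :=
    fun i hi hij => (Finset.mem_insert.1 hi).resolve_left hij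
  constructor <;> simp only [ShelfState.fresh, Set.mem_insert_iff, forall_eq_or_imp]
  · exact hl
  · exact h.width_nonneg
  · linarith
  · exact hc2
  · exact ⟨⟨hl, ht0⟩, h.nonneg⟩
  · exact ⟨by linarith, h.le_right⟩
  · exact ⟨by linarith, fun r hr => (h.le_ceil r hr).trans hc1⟩
  · refine ⟨Or.inr (by linarith), fun r hr => ?_⟩
    rcases h.below_top r hr with h1 | h1
    · exact Or.inl h1
    · exact Or.inr (by linarith)
  · intro i hi
    by_cases hij : i = shelfClass p.2
    · subst hij
      simp only [Function.update_self]
      refine ⟨Or.inl le_rfl, fun r hr => ?_⟩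
      rcases h.below_top r hr with h1 | h1
      · exact Or.inl (by linarith)
      · exact Or.inr (Or.inl h1)
    · simp only [Function.update_of_ne hij]
      exact ⟨Or.inr (Or.inr (h.shelf_le_top i (hmem i hi hij))), h.free i (hmem i hi hij)⟩
  · intro i hi
    by_cases hij : i = shelfClass p.2
    · subst hij
      simpa only [Function.update_self] using hw0.le
    · simpa only [Function.update_of_ne hij] using h.used_nonneg i (hmem i hi hij)
  · intro i hi
    by_cases hij : i = shelfClass p.2
    · subst hij
      simpa only [Function.update_self] using ht0
    · simpa only [Function.update_of_ne hij] using h.base_nonneg i (hmem i hi hij)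
  · intro i hi
    by_cases hij : i = shelfClass p.2
    · subst hij
      simp only [Function.update_self, le_refl]
    · have := h.shelf_le_top i (hmem i hi hij)
      simp only [Function.update_of_ne hij]
      linarith
  · intro i hi k hk hik
    by_cases hij : i = shelfClass p.2
    · subst hij
      simp only [Function.update_self, Function.update_of_ne hik.symm]
      exact Or.inr (h.shelf_le_top k (hmem k hk hik.symm))
    · by_cases hkj : k = shelfClass p.2
      · subst hkj
        simp only [Function.update_self, Function.update_of_ne hij]
        exact Or.inl (h.shelf_le_top i (hmem i hi hij))
      · simp only [Function.update_of_ne hij, Function.update_of_ne hkj]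
        exact h.shelves_separated i (hmem i hi hij) k (hmem k hk hkj) hik

lemma Geometric.place (h : s.Geometric) (hp : PiecePos p) (hw : p.1 ≤ s.width) :
    (s.place p).Geometric := by
  unfold ShelfState.place
  split_ifs with hf
  · exact h.reuse hp hf
  · exact h.fresh hp hw

lemma le_width_widen (hp : PiecePos p) : p.1 ≤ (s.widen p).width := by
  have h1 : p.1 ≤ max p.1 s.width := le_max_left _ _
  have h2 := hp.1
  simp only [ShelfState.widen]
  linarith

lemma Geometric.step (h : s.Geometric) (hp : PiecePos p) : (s.step p).Geometric := by
  unfold ShelfState.step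
  split_ifs with ha
  · exact h.tally.place hp ha.1
  · exact h.tally.widen.place hp (le_width_widen hp)

lemma rects_place : (s.place p).rects = insert (p, (s.place p).pos) s.rects := by
  unfold place
  split_ifs <;> rfl

lemma rects_step : (s.step p).rects = insert (p, (s.step p).pos) s.rects := by
  unfold step
  split_ifs <;> exact rects_place

lemma Geometric.separated_place (h : s.Geometric) {r : PlacedPiece} (hr : r ∈ s.rects) :
    Separated r (p, (s.place p).pos) := by
  have hh := le_shelfHeight p.2
  unfold ShelfState.place
  split_ifs with hf
  · rcases h.free _ hf.1 r hr with h1 | h1 | h1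
    · exact Or.inl h1
    · exact Or.inr (Or.inr (Or.inl h1))
    · refine Or.inr (Or.inr (Or.inr ?_))
      simp only [ShelfState.reuse]
      linarith
  · rcases h.below_top r hr with h1 | h1
    · exact Or.inl h1
    · exact Or.inr (Or.inr (Or.inl h1))

lemma Geometric.separated_step (h : s.Geometric) {r : PlacedPiece} (hr : r ∈ s.rects) :
    Separated r (p, (s.step p).pos) := by
  unfold ShelfState.step
  split_ifs
  · exact h.tally.separated_place hr
  · exact h.tally.widen.separated_place hr

/-! ### The potential argument for the height of the current box -/

/-- The area below `top` in the current box is, up to the free parts of the open shelves, covered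
by a constant multiple of the area of the pieces; `a` is the part of that area not yet used. -/
structure Potential (s : ShelfState) (a : ℝ) : Prop where
  bound : s.width * s.top + a ≤
    ∑ j ∈ s.shelves, (2 : ℝ) ^ j * (s.width - s.used j) + 4 * s.area
  slack_le : a ≤ 4 * s.area
  used_nonneg : ∀ j ∈ s.shelves, 0 ≤ s.used j
  height_le : ∀ j ∈ s.shelves, (2 : ℝ) ^ j ≤ 2 * s.maxH

lemma Potential.width_mul_top_le {a : ℝ} (h : s.Potential a) (ha : 0 ≤ a)
    (hS : 0 ≤ s.width) (hH : 0 ≤ s.maxH) :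
    s.width * s.top ≤ 4 * s.maxH * s.width + 4 * s.area := by
  have h1 : ∑ j ∈ s.shelves, (2 : ℝ) ^ j * (s.width - s.used j) ≤
      (∑ j ∈ s.shelves, (2 : ℝ) ^ j) * s.width := by
    rw [Finset.sum_mul]
    refine Finset.sum_le_sum fun j hj => ?_
    have := h.used_nonneg j hj
    gcongr
    linarith
  have h2 := sum_two_zpow_le_of_forall_le (by linarith) h.height_le
  have h3 := mul_le_mul_of_nonneg_right h2 hS
  have h4 := h.bound
  linarith

lemma Potential.tally (h : s.Potential 0) : (s.tally p).Potential (4 * (p.1 * p.2)) where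
  bound := by
    have := h.bound
    simp only [ShelfState.tally]
    linarith
  slack_le := by
    have := h.slack_le
    simp only [ShelfState.tally]
    linarith
  used_nonneg := h.used_nonneg
  height_le j hj := (h.height_le j hj).trans
    (mul_le_mul_of_nonneg_left (le_max_left _ _) zero_le_two)

lemma Potential.widen {a : ℝ} (h : s.Potential a) : (s.widen p).Potential a where
  bound := by simpa [ShelfState.widen] using h.slack_le
  slack_le := h.slack_le
  used_nonneg := by simp [ShelfState.widen]
  height_le := by simp [ShelfState.widen]

lemma sum_update_insert (F : Finset ℤ) (S : ℝ) (u : ℤ → ℝ) (j : ℤ) (v : ℝ) :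
    ∑ i ∈ insert j F, (2 : ℝ) ^ i * (S - Function.update u j v i) =
      2 ^ j * (S - v) + ∑ i ∈ F.erase j, (2 : ℝ) ^ i * (S - u i) := by
  rw [← Finset.insert_erase (Finset.mem_insert_self j F), Finset.erase_insert_eq_erase,
    Finset.sum_insert (Finset.notMem_erase j F), Function.update_self]
  congr 1
  refine Finset.sum_congr rfl fun i hi => ?_
  rw [Function.update_of_ne (Finset.ne_of_mem_erase hi)]

lemma Potential.place (h : s.Potential (4 * (p.1 * p.2))) (hp : PiecePos p)
    (hH : p.2 ≤ s.maxH) : (s.place p).Potential 0 := by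
  have hw := hp.1
  have h2 := shelfHeight_le hp.2
  have hpos : (0 : ℝ) < 2 ^ shelfClass p.2 := by positivity
  have hmul : (2 : ℝ) ^ shelfClass p.2 * p.1 ≤ 2 * (p.1 * p.2) := by nlinarith
  have harea : 0 ≤ p.1 * p.2 := mul_nonneg hp.1.le hp.2.le
  have hb := h.bound
  have hsl := h.slack_le
  unfold ShelfState.place
  split_ifs with hf
  · obtain ⟨hj, hu⟩ := hf
    refine ⟨?_, ?_, ?_, h.height_le⟩
    · have h1 := sum_update_insert s.shelves s.width s.used (shelfClass p.2)
        (s.used (shelfClass p.2) + p.1)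
      rw [Finset.insert_eq_of_mem hj] at h1
      have h3 := Finset.add_sum_erase s.shelves
        (fun i => (2 : ℝ) ^ i * (s.width - s.used i)) hj
      simp only [ShelfState.reuse]
      rw [h1]
      linarith
    · simp only [ShelfState.reuse]
      linarith
    · intro i hi
      simp only [ShelfState.reuse] at hi ⊢
      by_cases hij : i = shelfClass p.2
      · subst hij
        have := h.used_nonneg _ hi
        simp only [Function.update_self]
        linarith
      · simpa only [Function.update_of_ne hij] using h.used_nonneg i hi
  · refine ⟨?_, ?_, ?_, ?_⟩
    · simp only [ShelfState.fresh]
      rw [sum_update_insert]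
      by_cases hj : shelfClass p.2 ∈ s.shelves
      · have h3 := Finset.add_sum_erase s.shelves
          (fun i => (2 : ℝ) ^ i * (s.width - s.used i)) hj
        have h4 : s.width < s.used (shelfClass p.2) + p.1 := by
          by_contra! h5
          exact hf ⟨hj, h5⟩
        have h5 := mul_lt_mul_of_pos_left h4 hpos
        linarith
      · rw [Finset.erase_eq_of_notMem hj]
        linarith
    · simp only [ShelfState.fresh]
      linarith
    · intro i hi
      simp only [ShelfState.fresh] at hi ⊢
      by_cases hij : i = shelfClass p.2
      · subst hij
        simpa only [Function.update_self] using hw.le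
      · simpa only [Function.update_of_ne hij] using
          h.used_nonneg i ((Finset.mem_insert.1 hi).resolve_left hij)
    · intro i hi
      simp only [ShelfState.fresh] at hi ⊢
      rcases Finset.mem_insert.1 hi with rfl | hi
      · linarith
      · exact h.height_le i hi

/-! ### Bounds on the size of the packing -/

/-- Bounds on the box sizes in terms of the statistics of the stream. -/
structure Bounded (s : ShelfState) : Prop where
  maxW_nonneg : 0 ≤ s.maxW
  maxH_nonneg : 0 ≤ s.maxH
  area_nonneg : 0 ≤ s.area
  area_le : s.area ≤ s.count * (s.maxW * s.maxH)
  left_le : s.left ≤ s.width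
  width_nonneg : 0 ≤ s.width
  width_le : s.width ≤ 2 * s.maxW * Real.sqrt s.count
  top_le_ceil : s.top ≤ s.ceil
  ceil_nonneg : 0 ≤ s.ceil
  ceil_le : s.ceil ≤ 8 * s.maxH * Real.sqrt s.count
  width_mul_ceil_le : s.width * s.ceil ≤
    16 * (s.maxW * s.maxH * Real.sqrt s.count + s.area)

lemma Bounded.tally (h : s.Bounded) (hp : PiecePos p) : (s.tally p).Bounded := by
  have hW := h.maxW_nonneg
  have hH := h.maxH_nonneg
  have hw := hp.1.le
  have hh := hp.2.le
  have hW1 : s.maxW ≤ max s.maxW p.1 := le_max_left _ _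
  have hH1 : s.maxH ≤ max s.maxH p.2 := le_max_left _ _
  have hW2 : p.1 ≤ max s.maxW p.1 := le_max_right _ _
  have hH2 : p.2 ≤ max s.maxH p.2 := le_max_right _ _
  have hq : Real.sqrt s.count ≤ Real.sqrt (s.count + 1) := Real.sqrt_le_sqrt (by linarith)
  have hA : 0 ≤ p.1 * p.2 := mul_nonneg hw hh
  constructor <;> simp only [ShelfState.tally, Nat.cast_add, Nat.cast_one]
  · linarith
  · linarith
  · linarith [h.area_nonneg]
  · have h1 : s.maxW * s.maxH ≤ max s.maxW p.1 * max s.maxH p.2 := by gcongr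
    have h2 : p.1 * p.2 ≤ max s.maxW p.1 * max s.maxH p.2 := by gcongr
    have h3 := mul_le_mul_of_nonneg_left h1 (Nat.cast_nonneg (α := ℝ) s.count)
    linarith [h.area_le]
  · exact h.left_le
  · exact h.width_nonneg
  · exact h.width_le.trans (by gcongr)
  · exact h.top_le_ceil
  · exact h.ceil_nonneg
  · exact h.ceil_le.trans (by gcongr)
  · exact h.width_mul_ceil_le.trans (by gcongr; linarith)

lemma place_frame : (s.place p).count = s.count ∧ (s.place p).maxW = s.maxW ∧
    (s.place p).maxH = s.maxH ∧ (s.place p).area = s.area ∧ (s.place p).left = s.left ∧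
    (s.place p).width = s.width := by
  unfold place
  split_ifs <;> exact ⟨rfl, rfl, rfl, rfl, rfl, rfl⟩

lemma ceil_place (h : s.top ≤ s.ceil) : (s.place p).ceil = max s.ceil (s.place p).top := by
  unfold place
  split_ifs
  · exact (max_eq_left h).symm
  · rfl

lemma Bounded.place (h : s.Bounded) (hP : s.Potential (4 * (p.1 * p.2))) (hp : PiecePos p)
    (hH : p.2 ≤ s.maxH) (ht : (s.place p).top ≤ 8 * s.maxH * Real.sqrt s.count) :
    (s.place p).Bounded := by
  have hb := (hP.place hp hH).width_mul_top_le le_rfl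
  obtain ⟨e1, e2, e3, e4, e5, e6⟩ := place_frame (s := s) (p := p)
  have hc := ceil_place (p := p) h.top_le_ceil
  rw [e6, e3, e4] at hb
  replace hb := hb h.width_nonneg h.maxH_nonneg
  constructor
  · rw [e2]; exact h.maxW_nonneg
  · rw [e3]; exact h.maxH_nonneg
  · rw [e4]; exact h.area_nonneg
  · rw [e1, e2, e3, e4]; exact h.area_le
  · rw [e5, e6]; exact h.left_le
  · rw [e6]; exact h.width_nonneg
  · rw [e6, e1, e2]; exact h.width_le
  · rw [hc]; exact le_max_right _ _
  · rw [hc]; exact h.ceil_nonneg.trans (le_max_left _ _)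
  · rw [hc, e3, e1]; exact max_le h.ceil_le ht
  · rw [hc, e1, e2, e3, e4, e6, mul_max_of_nonneg _ _ h.width_nonneg]
    refine max_le h.width_mul_ceil_le (hb.trans ?_)
    have h1 := mul_le_mul_of_nonneg_left h.width_le h.maxH_nonneg
    have h2 : 0 ≤ s.maxW * s.maxH * Real.sqrt s.count :=
      mul_nonneg (mul_nonneg h.maxW_nonneg h.maxH_nonneg) (Real.sqrt_nonneg _)
    have h3 := h.area_nonneg
    linarith

lemma Bounded.widen (h : s.Bounded) (hP : s.Potential (4 * (p.1 * p.2))) (hp : PiecePos p)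
    (hW : p.1 ≤ s.maxW) (hH : p.2 ≤ s.maxH) (hn : 1 ≤ s.count) (ha : ¬ s.Acceptable p) :
    (s.widen p).Bounded := by
  have hq : 1 ≤ Real.sqrt s.count := by
    rw [Real.one_le_sqrt]
    exact_mod_cast hn
  have hq2 : Real.sqrt s.count * Real.sqrt s.count = s.count :=
    Real.mul_self_sqrt (Nat.cast_nonneg _)
  have hb := (hP.place hp hH).width_mul_top_le le_rfl
  obtain ⟨e1, e2, e3, e4, e5, e6⟩ := place_frame (s := s) (p := p)
  rw [e6, e3, e4] at hb
  replace hb := hb h.width_nonneg h.maxH_nonneg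
  have hS := h.width_nonneg
  have hW0 := h.maxW_nonneg
  have hA0 := h.area_nonneg
  have hA := h.area_le
  have hHpos : 0 < s.maxH := hp.2.trans_le hH
  have hc := h.ceil_le
  have hceil := h.ceil_nonneg
  have hleft := h.left_le
  have key : max p.1 s.width ≤ s.maxW * Real.sqrt s.count ∧
      max p.1 s.width * (s.maxH * Real.sqrt s.count) ≤
        s.maxW * s.maxH * Real.sqrt s.count + s.area := by
    by_cases hw : p.1 ≤ s.width
    · rw [max_eq_right hw]
      have ht : 8 * s.maxH * Real.sqrt s.count < (s.place p).top := by
        by_contra! h1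
        exact ha ⟨hw, h1⟩
      have h1 := mul_le_mul_of_nonneg_left ht.le hS
      have h2 : s.maxH * s.width * 1 ≤ s.maxH * s.width * Real.sqrt s.count := by gcongr
      have h3 : s.width * (s.maxH * Real.sqrt s.count) ≤ s.area := by linarith
      have h4 : 0 ≤ s.maxW * s.maxH * Real.sqrt s.count := by positivity
      refine ⟨?_, by linarith⟩
      have h5 : 0 < s.maxH * Real.sqrt s.count := by positivity
      refine le_of_mul_le_mul_right ?_ h5
      rw [← hq2] at hA
      linarith
    · rw [max_eq_left (le_of_not_ge hw)]
      have h1 : s.maxW * 1 ≤ s.maxW * Real.sqrt s.count := by gcongr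
      refine ⟨by linarith, ?_⟩
      have h2 : p.1 * (s.maxH * Real.sqrt s.count) ≤
        s.maxW * (s.maxH * Real.sqrt s.count) := by gcongr
      linarith
  have hm : s.width ≤ max p.1 s.width := le_max_right _ _
  constructor <;> simp only [ShelfState.widen]
  · exact hW0
  · exact hHpos.le
  · exact hA0
  · exact hA
  · linarith
  · linarith
  · linarith [key.1]
  · exact hceil
  · exact hceil
  · exact hc
  · have h1 : max p.1 s.width * s.ceil ≤
      max p.1 s.width * (8 * s.maxH * Real.sqrt s.count) :=
      mul_le_mul_of_nonneg_left hc (hS.trans hm)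
    linarith [key.2]

lemma Bounded.step (h : s.Bounded) (hP : s.Potential 0) (hp : PiecePos p) :
    (s.step p).Bounded ∧ (s.step p).Potential 0 := by
  have hW : p.1 ≤ (s.tally p).maxW := le_max_right _ _
  have hH : p.2 ≤ (s.tally p).maxH := le_max_right _ _
  have hn : 1 ≤ (s.tally p).count := Nat.le_add_left 1 s.count
  have hB := h.tally hp
  have hQ := hP.tally (p := p)
  generalize ht : s.tally p = t at *
  unfold ShelfState.step
  rw [ht]
  split_ifs with ha
  · exact ⟨hB.place hQ hp hH ha.2, hQ.place hp hH⟩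
  · refine ⟨(hB.widen hQ hp hW hH hn ha).place hQ.widen hp hH ?_, hQ.widen.place hp hH⟩
    have h1 : ((t.widen p).place p).top = 2 ^ shelfClass p.2 := by
      simp [ShelfState.place, Fits, ShelfState.widen, ShelfState.fresh]
    have hq : 1 ≤ Real.sqrt t.count := by
      rw [Real.one_le_sqrt]
      exact_mod_cast hn
    have h2 := shelfHeight_le hp.2
    have h3 := hB.maxH_nonneg
    have h4 := mul_le_mul_of_nonneg_left hq h3
    rw [h1]
    change _ ≤ 8 * t.maxH * Real.sqrt t.count
    linarith

/-! ### Running the algorithm -/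

/-- The state after processing a stream. -/
noncomputable def run (L : List Piece) : ShelfState := L.foldl step init

lemma run_concat (L : List Piece) (p : Piece) : run (L ++ [p]) = (run L).step p := by
  simp [run]

lemma run_invariants (L : List Piece) (hL : ∀ p ∈ L, PiecePos p) :
    (run L).Geometric ∧ (run L).Bounded ∧ (run L).Potential 0 := by
  induction L using List.reverseRecOn with
  | nil =>
    refine ⟨Geometric.init, ?_, ?_⟩ <;> constructor <;> simp [run, init]
  | append_singleton L p ih =>
    obtain ⟨hG, hB, hP⟩ := ih fun q hq => hL q (by simp [hq])
    have hp : PiecePos p := hL p (by simp)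
    rw [run_concat]
    exact ⟨hG.step hp, hB.step hP hp⟩

lemma step_statistics : (s.step p).count = s.count + 1 ∧ (s.step p).maxW = max s.maxW p.1 ∧
    (s.step p).maxH = max s.maxH p.2 ∧ (s.step p).area = s.area + p.1 * p.2 := by
  unfold step
  split_ifs
  · obtain ⟨e1, e2, e3, e4, -, -⟩ := place_frame (s := s.tally p) (p := p)
    exact ⟨e1, e2, e3, e4⟩
  · obtain ⟨e1, e2, e3, e4, -, -⟩ := place_frame (s := (s.tally p).widen p) (p := p)
    exact ⟨e1, e2, e3, e4⟩

lemma run_count (L : List Piece) : (run L).count = L.length := by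
  induction L using List.reverseRecOn with
  | nil => rfl
  | append_singleton L p ih => rw [run_concat, step_statistics.1, ih]; simp

lemma run_area (L : List Piece) : (run L).area = (L.map fun p => p.1 * p.2).sum := by
  induction L using List.reverseRecOn with
  | nil => rfl
  | append_singleton L p ih => rw [run_concat, step_statistics.2.2.2, ih]; simp

lemma run_maxW (L : List Piece) : (run L).maxW = 0 ∨ ∃ p ∈ L, (run L).maxW = p.1 := by
  induction L using List.reverseRecOn with
  | nil => exact Or.inl rfl
  | append_singleton L p ih =>
    rw [run_concat, step_statistics.2.1]
    rcases max_choice (run L).maxW p.1 with h | h <;> rw [h]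
    · rcases ih with ih | ⟨q, hq, ih⟩
      · exact Or.inl ih
      · exact Or.inr ⟨q, by simp [hq], ih⟩
    · exact Or.inr ⟨p, by simp, rfl⟩

lemma run_maxH (L : List Piece) : (run L).maxH = 0 ∨ ∃ p ∈ L, (run L).maxH = p.2 := by
  induction L using List.reverseRecOn with
  | nil => exact Or.inl rfl
  | append_singleton L p ih =>
    rw [run_concat, step_statistics.2.2.1]
    rcases max_choice (run L).maxH p.2 with h | h <;> rw [h]
    · rcases ih with ih | ⟨q, hq, ih⟩
      · exact Or.inl ih
      · exact Or.inr ⟨q, by simp [hq], ih⟩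
    · exact Or.inr ⟨p, by simp, rfl⟩

/-- The online strategy: the position chosen for the last piece. -/
noncomputable def strategy (L : List Piece) : ℝ × ℝ := (run L).pos

lemma mem_rects_run (L : List Piece) (i : ℕ) (hi : i < L.length) :
    (L[i], strategy (L.take (i + 1))) ∈ (run L).rects := by
  induction L using List.reverseRecOn with
  | nil => simp at hi
  | append_singleton L p ih =>
    rw [run_concat, rects_step]
    rcases Nat.lt_or_ge i L.length with h | h
    · right
      rw [List.getElem_append_left h, List.take_append_of_le_length h]
      exact ih h
    · have h1 : i = L.length := by
        simp at hi
        omega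
      subst h1
      left
      rw [List.take_of_length_le (by simp), strategy, run_concat]
      simp

lemma separated_of_lt (L : List Piece) (hL : ∀ p ∈ L, PiecePos p) {i j : ℕ} (hij : i < j)
    (hj : j < L.length) :
    Separated (L[i], strategy (L.take (i + 1))) (L[j], strategy (L.take (j + 1))) := by
  have hG := (run_invariants (L.take j) fun p hp => hL p (List.mem_of_mem_take hp)).1
  have hm := mem_rects_run (L.take j) i (by simp; omega)
  rw [List.getElem_take, List.take_take, min_eq_left (Nat.succ_le_of_lt hij)] at hm
  have := hG.separated_step (p := L[j]) hm
  rwa [← run_concat, List.take_concat_get' L j hj] at this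

end ShelfState

open ShelfState

lemma strategyValid_strategy : StrategyValid strategy := by
  intro L hL i j hij
  rcases lt_or_gt_of_ne hij with h | h
  · exact (separated_of_lt L hL h j.2).disjoint_interior
  · exact (separated_of_lt L hL h i.2).symm.disjoint_interior

/-! ### Bounding boxes -/

section BoundingBox

variable {T : Set (ℝ × ℝ)} {L : List Piece} {pos : Fin L.length → ℝ × ℝ}

lemma mul_le_mul_of_subset_box {X Y : ℝ} (hne : T.Nonempty)
    (hT : T ⊆ Set.Icc 0 X ×ˢ Set.Icc 0 Y) : boxWidth T * boxHeight T ≤ X * Y := by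
  have h1 : boxWidth T ≤ X := by
    have h2 : sSup (Prod.fst '' T) ≤ X :=
      csSup_le (hne.image _) (by rintro _ ⟨z, hz, rfl⟩; exact (hT hz).1.2)
    have h3 : 0 ≤ sInf (Prod.fst '' T) :=
      le_csInf (hne.image _) (by rintro _ ⟨z, hz, rfl⟩; exact (hT hz).1.1)
    unfold boxWidth
    linarith
  have h2 : boxHeight T ≤ Y := by
    have h2 : sSup (Prod.snd '' T) ≤ Y :=
      csSup_le (hne.image _) (by rintro _ ⟨z, hz, rfl⟩; exact (hT hz).2.2)
    have h3 : 0 ≤ sInf (Prod.snd '' T) :=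
      le_csInf (hne.image _) (by rintro _ ⟨z, hz, rfl⟩; exact (hT hz).2.1)
    unfold boxHeight
    linarith
  have h3 : 0 ≤ boxHeight T := by
    have hb : BddAbove (Prod.snd '' T) :=
      ⟨Y, by rintro _ ⟨z, hz, rfl⟩; exact (hT hz).2.2⟩
    have hb' : BddBelow (Prod.snd '' T) :=
      ⟨0, by rintro _ ⟨z, hz, rfl⟩; exact (hT hz).2.1⟩
    exact sub_nonneg.2 (csInf_le_csSup (hne.image _) hb' hb)
  obtain ⟨z, hz⟩ := hne
  have h4 : 0 ≤ X := (hT hz).1.1.trans (hT hz).1.2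
  exact mul_le_mul h1 h2 h3 h4

lemma isCompact_packedSet : IsCompact (packedSet L pos) :=
  isCompact_iUnion fun _ => isCompact_Icc.prod isCompact_Icc

lemma le_boxWidth_packedSet (hL : ∀ p ∈ L, PiecePos p) (i : Fin L.length) :
    (L.get i).1 ≤ boxWidth (packedSet L pos) := by
  have hc : IsCompact (Prod.fst '' packedSet L pos) := isCompact_packedSet.image continuous_fst
  have hi := hL _ (L.get_mem i)
  have hw := hi.1
  have hh := hi.2
  have h1 : (pos i).1 + (L.get i).1 ≤ sSup (Prod.fst '' packedSet L pos) :=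
    le_csSup hc.bddAbove ⟨((pos i).1 + (L.get i).1, (pos i).2), Set.mem_iUnion.2
      ⟨i, ⟨by linarith, le_rfl⟩, le_rfl, by linarith⟩, rfl⟩
  have h2 : sInf (Prod.fst '' packedSet L pos) ≤ (pos i).1 :=
    csInf_le hc.bddBelow ⟨pos i, Set.mem_iUnion.2
      ⟨i, ⟨le_rfl, by linarith⟩, le_rfl, by linarith⟩, rfl⟩
  unfold boxWidth
  linarith

lemma le_boxHeight_packedSet (hL : ∀ p ∈ L, PiecePos p) (i : Fin L.length) :
    (L.get i).2 ≤ boxHeight (packedSet L pos) := by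
  have hc : IsCompact (Prod.snd '' packedSet L pos) := isCompact_packedSet.image continuous_snd
  have hi := hL _ (L.get_mem i)
  have hw := hi.1
  have hh := hi.2
  have h1 : (pos i).2 + (L.get i).2 ≤ sSup (Prod.snd '' packedSet L pos) :=
    le_csSup hc.bddAbove ⟨((pos i).1, (pos i).2 + (L.get i).2), Set.mem_iUnion.2
      ⟨i, ⟨le_rfl, by linarith⟩, by linarith, le_rfl⟩, rfl⟩
  have h2 : sInf (Prod.snd '' packedSet L pos) ≤ (pos i).2 :=
    csInf_le hc.bddBelow ⟨pos i, Set.mem_iUnion.2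
      ⟨i, ⟨le_rfl, by linarith⟩, le_rfl, by linarith⟩, rfl⟩
  unfold boxHeight
  linarith

lemma mul_le_areaCost (hL : ∀ p ∈ L, PiecePos p) {p q : Piece} (hp : p ∈ L) (hq : q ∈ L) :
    p.1 * q.2 ≤ areaCost L pos := by
  obtain ⟨i, rfl⟩ := List.get_of_mem hp
  obtain ⟨j, rfl⟩ := List.get_of_mem hq
  have h1 := le_boxWidth_packedSet (pos := pos) hL i
  have h2 := le_boxHeight_packedSet (pos := pos) hL j
  exact mul_le_mul h1 h2 (hL _ hq).2.le ((hL _ hp).1.le.trans h1)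

open MeasureTheory in
lemma sum_area_le_areaCost (hne : L ≠ []) (hL : ∀ p ∈ L, PiecePos p) (hpk : IsPacking L pos) :
    (L.map fun p => p.1 * p.2).sum ≤ areaCost L pos := by
  set T := packedSet L pos
  have hcT : IsCompact T := isCompact_packedSet
  have hc1 : IsCompact (Prod.fst '' T) := hcT.image continuous_fst
  have hc2 : IsCompact (Prod.snd '' T) := hcT.image continuous_snd
  have i₀ : Fin L.length := ⟨0, List.length_pos_iff.2 hne⟩
  have hW : 0 ≤ boxWidth T := (hL _ (L.get_mem i₀)).1.le.trans (le_boxWidth_packedSet hL i₀)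
  have hH : 0 ≤ boxHeight T := (hL _ (L.get_mem i₀)).2.le.trans (le_boxHeight_packedSet hL i₀)
  have hsub : (⋃ i ∈ (Finset.univ : Finset (Fin L.length)),
      interior (placedRect (L.get i) (pos i))) ⊆
      Set.Icc (sInf (Prod.fst '' T)) (sSup (Prod.fst '' T)) ×ˢ
        Set.Icc (sInf (Prod.snd '' T)) (sSup (Prod.snd '' T)) := by
    intro z hz
    simp only [Finset.mem_univ, Set.iUnion_true, Set.mem_iUnion] at hz
    obtain ⟨i, hi⟩ := hz
    have hzT : z ∈ T := Set.mem_iUnion.2 ⟨i, interior_subset hi⟩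
    have h1 := Set.mem_image_of_mem Prod.fst hzT
    have h2 := Set.mem_image_of_mem Prod.snd hzT
    exact ⟨⟨csInf_le hc1.bddBelow h1, le_csSup hc1.bddAbove h1⟩,
      csInf_le hc2.bddBelow h2, le_csSup hc2.bddAbove h2⟩
  have hvol := measure_mono (μ := (volume : Measure (ℝ × ℝ))) hsub
  rw [measure_biUnion_finset (fun i _ j _ hij => hpk i j hij)
    (fun i _ => isOpen_interior.measurableSet)] at hvol
  have hterm : ∀ i : Fin L.length, volume (interior (placedRect (L.get i) (pos i))) =
      ENNReal.ofReal ((L.get i).1 * (L.get i).2) := by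
    intro i
    rw [interior_placedRect, Measure.volume_eq_prod, Measure.prod_prod, Real.volume_Ioo,
      Real.volume_Ioo, ← ENNReal.ofReal_mul (by linarith [(hL _ (L.get_mem i)).1])]
    simp
  rw [Finset.sum_congr rfl fun i _ => hterm i, ← ENNReal.ofReal_sum_of_nonneg
    (fun i _ => mul_nonneg (hL _ (L.get_mem i)).1.le (hL _ (L.get_mem i)).2.le),
    Measure.volume_eq_prod, Measure.prod_prod, Real.volume_Icc, Real.volume_Icc,
    ← ENNReal.ofReal_mul (show 0 ≤ sSup (Prod.fst '' T) - sInf (Prod.fst '' T) from hW)] at hvol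
  replace hvol := (ENNReal.ofReal_le_ofReal_iff (mul_nonneg hW hH)).1 hvol
  have hsum : (L.map fun p => p.1 * p.2).sum =
      ∑ i : Fin L.length, (L.get i).1 * (L.get i).2 := by
    rw [← List.sum_ofFn]
    congr 1
    apply List.ext_get <;> simp
  rw [hsum]
  exact hvol

end BoundingBox

lemma algArea_strategy_le {L : List Piece} (hne : L ≠ []) (hL : ∀ p ∈ L, PiecePos p) :
    algArea strategy L ≤ (run L).width * 2 * (run L).ceil := by
  obtain ⟨hG, hB, -⟩ := run_invariants L hL
  have h1 : algArea strategy L ≤ ((run L).left + (run L).width) * (run L).ceil := by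
    refine mul_le_mul_of_subset_box ?_ ?_
    · have hp := hL _ (List.getElem_mem (List.length_pos_iff.2 hne))
      exact ⟨onlinePos strategy L ⟨0, List.length_pos_iff.2 hne⟩, Set.mem_iUnion.2
        ⟨⟨0, List.length_pos_iff.2 hne⟩, ⟨le_rfl, le_add_of_nonneg_right hp.1.le⟩,
          le_rfl, le_add_of_nonneg_right hp.2.le⟩⟩
    · refine Set.iUnion_subset fun i => ?_
      have hm := mem_rects_run L i i.2
      have h0 := hG.nonneg _ hm
      exact Set.prod_mono (Set.Icc_subset_Icc h0.1 (hG.le_right _ hm))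
        (Set.Icc_subset_Icc h0.2 (hG.le_ceil _ hm))
  have h2 := mul_le_mul_of_nonneg_right hB.left_le hB.ceil_nonneg
  linarith

/-- There exist a constant `C > 0` and a valid online
translation strategy `σ` such that for every nonempty finite stream `L` of
`n` pieces, `ALG_σ(L) ≤ C * √n * OPT(L)` (area of the bounding box). -/
theorem area_translation_sqrt_n_upper_bound :
    ∃ C : ℝ, 0 < C ∧ ∃ σ : List Piece → ℝ × ℝ, StrategyValid σ ∧
      ∀ L : List Piece, L ≠ [] → (∀ p ∈ L, PiecePos p) →
        algArea σ L ≤ C * Real.sqrt (L.length) * optArea L := by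
  refine ⟨64, by norm_num, strategy, strategyValid_strategy, fun L hne hL => ?_⟩
  obtain ⟨-, hB, -⟩ := run_invariants L hL
  have halg := algArea_strategy_le hne hL
  have hq : 1 ≤ Real.sqrt L.length := by
    rw [Real.one_le_sqrt]
    exact_mod_cast List.length_pos_iff.2 hne
  have hW := hB.maxW_nonneg
  have hH := hB.maxH_nonneg
  have harea : (run L).area ≤ optArea L := by
    refine le_csInf ⟨_, _, strategyValid_strategy L hL, rfl⟩ ?_
    rintro _ ⟨pos, hpk, rfl⟩
    rw [run_area]
    exact sum_area_le_areaCost hne hL hpk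
  have hbox : (run L).maxW * (run L).maxH ≤ optArea L := by
    refine le_csInf ⟨_, _, strategyValid_strategy L hL, rfl⟩ ?_
    rintro _ ⟨pos, hpk, rfl⟩
    have h0 : 0 ≤ areaCost L pos := by
      obtain ⟨p, hp⟩ := List.exists_mem_of_ne_nil L hne
      exact (mul_nonneg (hL p hp).1.le (hL p hp).2.le).trans (mul_le_areaCost hL hp hp)
    rcases run_maxW L with h1 | ⟨p, hp, h1⟩
    · simpa [h1] using h0
    · rcases run_maxH L with h2 | ⟨q, hq, h2⟩
      · simpa [h2] using h0
      · rw [h1, h2]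
        exact mul_le_areaCost hL hp hq
  have h1 := hB.width_mul_ceil_le
  rw [run_count] at h1
  have h2 := mul_le_mul_of_nonneg_right hbox (zero_le_one.trans hq)
  have h3 := mul_le_mul_of_nonneg_right harea (zero_le_one.trans hq)
  have h4 := mul_le_mul_of_nonneg_left hq hB.area_nonneg
  linarith
end

section
/- There exists a valid online translation strategy σ for streams of square pieces such that for every nonempty finite stream L of square pieces, ALG_σ(L) ≤ 6·OPT(L), where the cost of a packing is the area of the smallest axis-parallel square containing all placed squares. (A 6-competitive online algorithm for packing squares into a minimum-area bounding square.) -/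
open Set

/-! ### Bricks

A `k`-brick has short side `√2 ^ k` and long side `√2 ^ (k + 1)`; it is the union of two
`(k - 1)`-bricks. The direction of the short side alternates with the parity of `k`. The
coordinate directions are indexed by `Bool`. -/

/-- Length of the short side of a `k`-brick. -/
noncomputable def brickSide (k : ℤ) : ℝ := (√2) ^ k

/-- Extent of a `k`-brick in direction `p`. -/
noncomputable def brickExtent (p : Bool) (k : ℤ) : ℝ :=
  if decide (Even k) = p then brickSide k else brickSide (k + 1)

/-- Offset in direction `p` between the two `k`-bricks making up a `(k + 1)`-brick. -/
noncomputable def brickOffset (p : Bool) (k : ℤ) : ℝ :=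
  if decide (Even k) = p then brickSide k else 0

/-- The interior of the `k`-brick with lower left corner `c`. -/
def openBrick (k : ℤ) (c : ℝ × ℝ) : Set (ℝ × ℝ) :=
  Ioo c.1 (c.1 + brickExtent true k) ×ˢ Ioo c.2 (c.2 + brickExtent false k)

/-- The corner of the upper `k`-brick in the `(k + 1)`-brick with corner `c`. -/
noncomputable def shift (c : ℝ × ℝ) (k : ℤ) : ℝ × ℝ :=
  (c.1 + brickOffset true k, c.2 + brickOffset false k)

lemma brickSide_pos (k : ℤ) : 0 < brickSide k := by
  unfold brickSide; positivity

lemma brickSide_add_two (k : ℤ) : brickSide (k + 2) = 2 * brickSide k := by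
  unfold brickSide
  rw [zpow_add₀ (by positivity)]
  have : (√2 : ℝ) ^ (2 : ℤ) = 2 := by
    rw [zpow_ofNat]; exact Real.sq_sqrt (by norm_num)
  rw [this, mul_comm]

lemma brickSide_mono : Monotone brickSide := fun _ _ h =>
  zpow_le_zpow_right₀ Real.one_lt_sqrt_two.le h

lemma brickSide_sq_succ (k : ℤ) : brickSide (k + 1) ^ 2 = 2 * brickSide k ^ 2 := by
  unfold brickSide
  rw [zpow_add₀ (by positivity), mul_pow, zpow_one, Real.sq_sqrt (by norm_num)]
  ring

lemma brickExtent_succ (p : Bool) (k : ℤ) :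
    brickExtent p (k + 1) = brickOffset p k + brickExtent p k := by
  unfold brickExtent brickOffset
  have h := brickSide_add_two k
  rw [show k + 2 = k + 1 + 1 by ring] at h
  have hk : decide (Even (k + 1)) = !decide (Even k) := by
    rw [decide_eq_decide.2 Int.even_add_one, decide_not]
  rw [hk]
  generalize decide (Even k) = b
  cases b <;> cases p <;> simp [h, two_mul]

lemma brickOffset_nonneg (p : Bool) (k : ℤ) : 0 ≤ brickOffset p k := by
  unfold brickOffset
  split_ifs
  exacts [(brickSide_pos k).le, le_rfl]

lemma brickExtent_mono (p : Bool) : Monotone (brickExtent p) :=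
  monotone_int_of_le_succ fun k => by
    rw [brickExtent_succ]; linarith [brickOffset_nonneg p k]

lemma brickOffset_add_brickExtent_le (p : Bool) {i j : ℤ} (h : i < j) :
    brickOffset p i + brickExtent p i ≤ brickExtent p j := by
  rw [← brickExtent_succ]; exact brickExtent_mono p (by omega)

lemma brickSide_le_brickExtent (p : Bool) (k : ℤ) : brickSide k ≤ brickExtent p k := by
  unfold brickExtent
  split_ifs
  exacts [le_rfl, brickSide_mono (by omega)]

lemma openBrick_mono {i j : ℤ} (h : i ≤ j) (c : ℝ × ℝ) : openBrick i c ⊆ openBrick j c :=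
  prod_mono (Ioo_subset_Ioo_right (by linarith [brickExtent_mono true h]))
    (Ioo_subset_Ioo_right (by linarith [brickExtent_mono false h]))

lemma openBrick_shift_subset {i j : ℤ} (h : i < j) (c : ℝ × ℝ) :
    openBrick i (shift c i) ⊆ openBrick j c := by
  have h1 := brickOffset_add_brickExtent_le true h
  have h2 := brickOffset_add_brickExtent_le false h
  refine prod_mono (Ioo_subset_Ioo ?_ ?_) (Ioo_subset_Ioo ?_ ?_) <;> simp only [shift] <;>
    linarith [brickOffset_nonneg true i, brickOffset_nonneg false i]

lemma disjoint_openBrick_shift {k i : ℤ} (h : k ≤ i) (c : ℝ × ℝ) :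
    Disjoint (openBrick k c) (openBrick i (shift c i)) := by
  rw [Set.disjoint_left]
  rintro x ⟨⟨-, hx1⟩, ⟨-, hx2⟩⟩ ⟨⟨hy1, -⟩, ⟨hy2, -⟩⟩
  have h1 := brickExtent_mono true h
  have h2 := brickExtent_mono false h
  simp only [shift] at hy1 hy2
  by_cases hi : Even i
  · have : brickOffset true i = brickExtent true i := by simp [brickOffset, brickExtent, hi]
    linarith
  · have : brickOffset false i = brickExtent false i := by simp [brickOffset, brickExtent, hi]
    linarith

lemma interior_placedSq (s : ℝ) (q : ℝ × ℝ) :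
    interior (placedSq s q) = Ioo q.1 (q.1 + s) ×ˢ Ioo q.2 (q.2 + s) := by
  rw [placedSq, interior_prod_eq, interior_Icc, interior_Icc]

lemma interior_placedSq_subset_openBrick {s : ℝ} {k : ℤ} (h : s ≤ brickSide k) (q : ℝ × ℝ) :
    interior (placedSq s q) ⊆ openBrick k q := by
  rw [interior_placedSq]
  exact prod_mono (Ioo_subset_Ioo_right (by linarith [brickSide_le_brickExtent true k]))
    (Ioo_subset_Ioo_right (by linarith [brickSide_le_brickExtent false k]))

/-! ### Coordinates of free bricks -/

/-- A sufficient condition, stable under passing to upper halves of sub-bricks, for a `j`-brick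
with coordinate `y` in direction `p` to be safely usable once a volume of about `v` has been
used up. -/
def Usable (p : Bool) (j : ℤ) (y v : ℝ) : Prop :=
  (y = 0 ∧ 0 ≤ v) ∨ ∃ t d : ℝ, 0 < d ∧ d ≤ t ∧ 4 * t ^ 2 - d ^ 2 ≤ 3 * v ∧
    ((∃ i, j ≤ i ∧ decide (Even i) = p ∧ d = brickSide i ∧ y = 2 * t - d ∧
      (d = t ∨ 2 * d ≤ t)) ∨ y + brickExtent p j ≤ 2 * t - d / 2)

lemma Usable.mono {p : Bool} {j : ℤ} {y v v' : ℝ} (h : Usable p j y v) (hv : v ≤ v') :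
    Usable p j y v' := by
  rcases h with ⟨hy, h0⟩ | ⟨t, d, hd, hdt, h1, h2⟩
  · exact Or.inl ⟨hy, h0.trans hv⟩
  · exact Or.inr ⟨t, d, hd, hdt, by linarith, h2⟩

lemma Usable.shift {p : Bool} {i j : ℤ} {y v : ℝ} (h : Usable p j y v) (hij : i < j) :
    Usable p i (y + brickOffset p i) (v + brickSide i ^ 2) := by
  have hi := brickSide_pos i
  by_cases hp : decide (Even i) = p
  · have ho : brickOffset p i = brickSide i := by simp [brickOffset, hp]
    rw [ho]
    rcases h with ⟨hy, h0⟩ | ⟨t, d, hd, hdt, h1, ⟨m, hjm, hm, hdm, hy, h2⟩ | h2⟩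
    · exact Or.inr ⟨brickSide i, brickSide i, hi, le_rfl, by linarith,
        Or.inl ⟨i, le_rfl, hp, rfl, by linarith, Or.inl rfl⟩⟩
    · have hpar : Even i ↔ Even m := by simpa using hp.trans hm.symm
      obtain rfl | hlt : m = i + 2 ∨ i + 2 + 2 ≤ m := by
        rw [Int.even_iff, Int.even_iff] at hpar
        omega
      · rw [brickSide_add_two] at hdm
        refine Or.inr ⟨t, brickSide i, hi, by linarith, by subst hdm; nlinarith,
          Or.inl ⟨i, le_rfl, hp, rfl, by linarith, Or.inr (by linarith)⟩⟩
      · have hm4 := brickSide_mono hlt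
        rw [brickSide_add_two, brickSide_add_two, ← hdm] at hm4
        have he : brickExtent p i = brickSide i := by simp [brickExtent, hp]
        exact Or.inr ⟨t, d, hd, hdt, by nlinarith, Or.inr (by linarith)⟩
    · have he := brickOffset_add_brickExtent_le p hij
      rw [ho] at he
      exact Or.inr ⟨t, d, hd, hdt, by nlinarith, Or.inr (by linarith)⟩
  · have ho : brickOffset p i = 0 := by simp [brickOffset, hp]
    rw [ho, add_zero]
    refine Usable.mono ?_ (le_add_of_nonneg_right (sq_nonneg _))
    rcases h with h | ⟨t, d, hd, hdt, h1, ⟨m, hjm, hm⟩ | h2⟩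
    · exact Or.inl h
    · exact Or.inr ⟨t, d, hd, hdt, h1, Or.inl ⟨m, by omega, hm⟩⟩
    · exact Or.inr ⟨t, d, hd, hdt, h1, Or.inr (by linarith [brickExtent_mono p hij.le])⟩

lemma usable_brickOffset (p : Bool) (i : ℤ) :
    Usable p i (brickOffset p i) (brickSide i ^ 2) := by
  simpa using Usable.shift (p := p) (j := i + 1) (Or.inl ⟨rfl, le_rfl⟩) (lt_add_one i)

/-- The key estimate: placing a square of side `s` and size class `k` in a usable brick, when the
squares placed before have total area `a`. -/
lemma Usable.sq_le {p : Bool} {j k : ℤ} {y v s a : ℝ} (h : Usable p j y v) (hy : 0 ≤ y)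
    (hkj : k ≤ j) (hs : brickSide (k - 1) < s) (hs' : s ≤ brickSide k) (ha : 0 ≤ a)
    (hv : v ≤ 2 * a + brickSide k ^ 2) : (y + s) ^ 2 ≤ 6 * (a + s ^ 2) := by
  have hk := brickSide_pos (k - 1)
  have hs0 : 0 < s := hk.trans hs
  have hk2 := brickSide_sq_succ (k - 1)
  rw [sub_add_cancel] at hk2
  have hks : brickSide k ^ 2 ≤ 2 * s ^ 2 := by rw [hk2]; gcongr
  have fits : ∀ t d : ℝ, 0 < d → d ≤ t → 4 * t ^ 2 - d ^ 2 ≤ 3 * v → 0 ≤ y + s →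
      y + s ≤ 2 * t - d / 2 → (y + s) ^ 2 ≤ 6 * (a + s ^ 2) := by
    intro t d hd hdt h1 h0 h2
    calc (y + s) ^ 2 ≤ (2 * t - d / 2) ^ 2 := by gcongr
      _ ≤ 6 * (a + s ^ 2) := by nlinarith
  rcases h with ⟨rfl, -⟩ | ⟨t, d, hd, hdt, h1, ⟨i, hji, hi, hdi, rfl, h2⟩ | h2⟩
  · nlinarith [sq_nonneg s]
  · obtain rfl | rfl | hlt : k = i ∨ k = i - 1 ∨ k + 2 ≤ i := by omega
    · rw [← hdi] at hs' hv hks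
      rcases h2 with rfl | h2
      · have : d ≤ 1.42 * s := by nlinarith
        nlinarith
      · nlinarith [mul_nonneg (sub_nonneg.2 h2) (sub_nonneg.2 hs'), sq_nonneg (s - d), sq_nonneg s]
    · have e1 := brickSide_sq_succ (i - 1)
      have e2 := brickSide_add_two (i - 2)
      rw [sub_add_cancel, ← hdi] at e1 e2
      rw [show i - 1 - 1 = i - 2 by ring] at hs
      have hsd : s ≤ d := hs'.trans (hdi ▸ brickSide_mono (by omega))
      nlinarith [mul_nonneg (sub_nonneg.2 hdt) (sub_nonneg.2 hsd), sq_nonneg (5 * s - d),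
        sq_nonneg d]
    · have := brickSide_mono hlt
      rw [brickSide_add_two, ← hdi] at this
      exact fits t d hd hdt h1 (by linarith) (by linarith)
  · have hext := (brickSide_mono hkj).trans (brickSide_le_brickExtent p j)
    exact fits t d hd hdt h1 (by linarith) (by linarith)

/-! ### The strategy -/

/-- The size class of a square of side `s`: the shortest short side of a brick that is at least
`s` is `brickSide (sizeClass s)`. -/
noncomputable def sizeClass (s : ℝ) : ℤ :=
  Classical.epsilon fun k => brickSide (k - 1) < s ∧ s ≤ brickSide k

lemma sizeClass_spec {s : ℝ} (hs : 0 < s) :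
    brickSide (sizeClass s - 1) < s ∧ s ≤ brickSide (sizeClass s) := by
  obtain ⟨n, h1, h2⟩ := exists_mem_Ioc_zpow hs Real.one_lt_sqrt_two
  exact Classical.epsilon_spec (p := fun k => brickSide (k - 1) < s ∧ s ≤ brickSide k)
    ⟨n + 1, by simpa [brickSide] using h1, h2⟩

/-- The free bricks: at most one of each size class. -/
structure BrickState where
  free : Set ℤ
  corner : ℤ → ℝ × ℝ

/-- The smallest free size class that is at least `k`. -/
noncomputable def nextFree (F : Set ℤ) (k : ℤ) : ℤ :=
  Classical.epsilon fun j => k ≤ j ∧ j ∈ F ∧ ∀ i, k ≤ i → i < j → i ∉ F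

lemma nextFree_spec {F : Set ℤ} {k : ℤ} (h : ∃ j ∈ F, k ≤ j) :
    k ≤ nextFree F k ∧ nextFree F k ∈ F ∧ ∀ i, k ≤ i → i < nextFree F k → i ∉ F := by
  obtain ⟨j, hj, hkj⟩ := h
  obtain ⟨m, ⟨hm, hkm⟩, hmin⟩ :=
    Int.exists_least_of_bdd (P := fun j => j ∈ F ∧ k ≤ j) ⟨k, fun _ h => h.2⟩ ⟨j, hj, hkj⟩
  exact Classical.epsilon_spec (p := fun j => k ≤ j ∧ j ∈ F ∧ ∀ i, k ≤ i → i < j → i ∉ F)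
    ⟨m, hkm, hm, fun i hi him hiF => absurd (hmin i ⟨hiF, hi⟩) (by omega)⟩

open Classical in
/-- Use a `k`-brick, obtained by repeatedly halving the smallest free brick that is large
enough. -/
noncomputable def BrickState.use (S : BrickState) (k : ℤ) : BrickState where
  free := {i | (k ≤ i ∧ i < nextFree S.free k) ∨ (i ∈ S.free ∧ i ≠ nextFree S.free k)}
  corner i := if k ≤ i ∧ i < nextFree S.free k then shift (S.corner (nextFree S.free k)) i
    else S.corner i

/-- The free bricks once a `k`-brick at the origin has been used. -/
noncomputable def initialState (k : ℤ) : BrickState where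
  free := Ici k
  corner := shift 0

/-- The free bricks after the stream has been packed. -/
noncomputable def stateOf : List ℝ → BrickState
  | [] => initialState 0
  | s :: L => L.foldl (fun S t => S.use (sizeClass t)) (initialState (sizeClass s))

/-- The brick-halving strategy. -/
noncomputable def brickStrategy (L : List ℝ) : ℝ × ℝ :=
  if L.dropLast = [] then 0
  else (stateOf L.dropLast).corner
    (nextFree (stateOf L.dropLast).free (sizeClass (L.getLastD 0)))

lemma stateOf_concat {L : List ℝ} (hL : L ≠ []) (s : ℝ) :
    stateOf (L ++ [s]) = (stateOf L).use (sizeClass s) := by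
  cases L with
  | nil => exact absurd rfl hL
  | cons a L => simp [stateOf]

lemma brickStrategy_singleton (s : ℝ) : brickStrategy [s] = 0 := by
  simp [brickStrategy]

lemma brickStrategy_concat {L : List ℝ} (hL : L ≠ []) (s : ℝ) :
    brickStrategy (L ++ [s]) =
      (stateOf L).corner (nextFree (stateOf L).free (sizeClass s)) := by
  simp [brickStrategy, hL]

/-- Total area of the squares in a stream. -/
def totalArea (L : List ℝ) : ℝ := (L.map (· ^ 2)).sum

lemma totalArea_concat (L : List ℝ) (s : ℝ) : totalArea (L ++ [s]) = totalArea L + s ^ 2 := by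
  simp [totalArea]

lemma totalArea_nonneg (L : List ℝ) : 0 ≤ totalArea L :=
  List.sum_nonneg (by simp only [List.mem_map]; rintro _ ⟨x, -, rfl⟩; positivity)

/-- The invariant satisfied by the free bricks after squares of total area `a` have been packed;
`g i` bounds the volume (in units where a `k`-brick has volume `2 ^ k`) of what is used or free of
size class below `i`. -/
structure BrickState.Inv (S : BrickState) (a : ℝ) : Prop where
  exists_ge : ∀ k, ∃ j ∈ S.free, k ≤ j
  nonneg : ∀ j ∈ S.free, 0 ≤ (S.corner j).1 ∧ 0 ≤ (S.corner j).2
  disjoint : ∀ i ∈ S.free, ∀ j ∈ S.free, i < j →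
    Disjoint (openBrick i (S.corner i)) (openBrick j (S.corner j))
  exists_volume : ∃ g : ℤ → ℝ,
    (∀ i ∈ S.free, g (i + 1) = g i + brickSide i ^ 2) ∧ (∀ i ∉ S.free, g (i + 1) = g i) ∧
    (∀ i, g i ≤ 2 * a + brickSide i ^ 2) ∧
    ∀ i ∈ S.free, Usable true i (S.corner i).1 (g i) ∧ Usable false i (S.corner i).2 (g i)

lemma shift_nonneg {c : ℝ × ℝ} (h : 0 ≤ c.1 ∧ 0 ≤ c.2) (i : ℤ) :
    0 ≤ (shift c i).1 ∧ 0 ≤ (shift c i).2 :=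
  ⟨add_nonneg h.1 (brickOffset_nonneg true i), add_nonneg h.2 (brickOffset_nonneg false i)⟩

lemma inv_initialState {k : ℤ} {a : ℝ} (hk : brickSide k ^ 2 ≤ 2 * a) :
    (initialState k).Inv a where
  exists_ge j := ⟨max k j, mem_Ici.2 (le_max_left k j), le_max_right k j⟩
  nonneg j _ := shift_nonneg ⟨le_rfl, le_rfl⟩ j
  disjoint i _ j _ hij :=
    (disjoint_openBrick_shift le_rfl 0).mono_left (openBrick_shift_subset hij 0)
  exists_volume := by
    refine ⟨fun i => brickSide (max k i) ^ 2, ?_, ?_, ?_, ?_⟩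
    · intro i (hi : k ≤ i)
      simp only [max_eq_right hi, max_eq_right (show k ≤ i + 1 by omega), brickSide_sq_succ]
      ring
    · intro i (hi : ¬ k ≤ i)
      simp only [max_eq_left (show i ≤ k by omega), max_eq_left (show i + 1 ≤ k by omega)]
    · intro i
      rcases le_total k i with h | h
      · simp only [max_eq_right h]; nlinarith [brickSide_pos k]
      · simp only [max_eq_left h]; nlinarith [brickSide_pos i]
    · intro i (hi : k ≤ i)
      have h1 := usable_brickOffset true i
      have h2 := usable_brickOffset false i
      simp only [max_eq_right hi, initialState, shift, Prod.fst_zero, Prod.snd_zero, zero_add]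
      exact ⟨h1, h2⟩

/-- The volume bound does not change across size classes that are not free. -/
lemma eq_of_forall_notMem {F : Set ℤ} {g : ℤ → ℝ} (hg : ∀ i ∉ F, g (i + 1) = g i) {k j : ℤ}
    (hkj : k ≤ j) (h : ∀ i, k ≤ i → i < j → i ∉ F) : g j = g k := by
  induction j, hkj using Int.leInduction with
  | base => rfl
  | succ j hkj ih =>
    rw [hg j (h j hkj (by omega)), ih fun i h1 h2 => h i h1 (by omega)]

lemma BrickState.use_free_cases {S : BrickState} {k i : ℤ} (hi : i ∈ (S.use k).free)
    (hno : ∀ i, k ≤ i → i < nextFree S.free k → i ∉ S.free) :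
    (k ≤ i ∧ i < nextFree S.free k ∧
      (S.use k).corner i = shift (S.corner (nextFree S.free k)) i) ∨
    (i ∈ S.free ∧ i ≠ nextFree S.free k ∧ (S.use k).corner i = S.corner i) := by
  rcases hi with h | h
  · exact Or.inl ⟨h.1, h.2, if_pos h⟩
  · exact Or.inr ⟨h.1, h.2, if_neg fun h' => hno i h'.1 h'.2 h.1⟩

lemma BrickState.Inv.use {S : BrickState} {a b : ℝ} (hS : S.Inv a) {k : ℤ}
    (hk : brickSide k ^ 2 ≤ 2 * b) : (S.use k).Inv (a + b) := by
  obtain ⟨hkj, hj, hno⟩ := nextFree_spec (hS.exists_ge k)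
  have cases {i : ℤ} (hi : i ∈ (S.use k).free) := BrickState.use_free_cases hi hno
  have hfree (i : ℤ) : i ∈ (S.use k).free ↔
    (k ≤ i ∧ i < nextFree S.free k) ∨ (i ∈ S.free ∧ i ≠ nextFree S.free k) := Iff.rfl
  generalize nextFree S.free k = j at *
  constructor
  · intro l
    obtain ⟨m, hm, hlm⟩ := hS.exists_ge (max l (j + 1))
    exact ⟨m, (hfree m).2 (Or.inr ⟨hm, by omega⟩), by omega⟩
  · intro i hi
    rcases cases hi with ⟨-, -, h⟩ | ⟨h, -, h'⟩
    · rw [h]; exact shift_nonneg (hS.nonneg j hj) i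
    · rw [h']; exact hS.nonneg i h
  · intro i hi m hm him
    have old {i m : ℤ} (hi : i ∈ S.free) (hm : m ∈ S.free) (hne : i ≠ m) :
        Disjoint (openBrick i (S.corner i)) (openBrick m (S.corner m)) :=
      hne.lt_or_gt.elim (hS.disjoint i hi m hm) fun h => (hS.disjoint m hm i hi h).symm
    rcases cases hi with ⟨-, h1, h2⟩ | ⟨h1, h2, h3⟩ <;>
      rcases cases hm with ⟨-, h4, h5⟩ | ⟨h4, h5, h6⟩
    · rw [h2, h5]
      exact (disjoint_openBrick_shift le_rfl _).mono_left (openBrick_shift_subset him _)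
    · rw [h2, h6]
      exact (old hj h4 h5.symm).mono_left (openBrick_shift_subset h1 _)
    · rw [h3, h5]
      exact (old h1 hj h2).mono_right (openBrick_shift_subset h4 _)
    · rw [h3, h6]
      exact old h1 h4 him.ne
  · obtain ⟨g, hg1, hg2, hg3, hg4⟩ := hS.exists_volume
    have hconst {i : ℤ} (hki : k ≤ i) (hij : i ≤ j) : g i = g k :=
      eq_of_forall_notMem hg2 hki fun l h1 h2 => hno l h1 (by omega)
    have hgj := hg1 j hj
    rw [hconst hkj le_rfl] at hgj
    have hpos := sq_nonneg (brickSide k)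
    refine ⟨fun i => if i ≤ k then g i + brickSide k ^ 2
      else if i ≤ j then g k + brickSide i ^ 2 else g i, ?_, ?_, ?_, ?_⟩
    · intro i hi
      have hsucc := brickSide_sq_succ i
      have hi' := (hfree i).1 hi
      have hg := hg1 i
      have hik : i = k → g i = g k := fun h => by rw [h]
      have hbk : i = k → brickSide i = brickSide k := fun h => by rw [h]
      simp only
      grind
    · intro i hi
      have hi' := mt (hfree i).2 hi
      have hg := hg1 i
      have hg' := hg2 i
      have hik : j = k → g j = g k := fun h => by rw [h]
      simp only
      grind
    · intro i
      have := hg3 i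
      have := hg3 k
      simp only
      split_ifs <;> linarith
    · intro i hi
      rcases cases hi with ⟨h1, h2, h3⟩ | ⟨h1, h2, h3⟩ <;> rw [h3]
      · obtain ⟨u1, u2⟩ := hg4 j hj
        rw [hconst hkj le_rfl] at u1 u2
        have hle : g k + brickSide i ^ 2 ≤ (if i ≤ k then g i + brickSide k ^ 2
            else if i ≤ j then g k + brickSide i ^ 2 else g i) := by
          split_ifs with h4 h5
          · obtain rfl : i = k := by omega
            exact le_rfl
          · exact le_rfl
          · omega
        exact ⟨(u1.shift h2).mono hle, (u2.shift h2).mono hle⟩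
      · have hle : g i ≤ (if i ≤ k then g i + brickSide k ^ 2
            else if i ≤ j then g k + brickSide i ^ 2 else g i) := by
          split_ifs with h4 h5
          · linarith
          · rw [hconst (by omega) h5]; linarith [sq_nonneg (brickSide i)]
          · exact le_rfl
        exact ⟨(hg4 i h1).1.mono hle, (hg4 i h1).2.mono hle⟩

lemma inv_stateOf {L : List ℝ} (hL : L ≠ []) (hpos : ∀ s ∈ L, 0 < s) :
    (stateOf L).Inv (totalArea L) := by
  induction L using List.reverseRecOn with
  | nil => exact absurd rfl hL
  | append_singleton L s ih =>
    have hs := sizeClass_spec (hpos s (by simp))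
    have hk : brickSide (sizeClass s) ^ 2 ≤ 2 * s ^ 2 := by
      have h := brickSide_sq_succ (sizeClass s - 1)
      rw [sub_add_cancel] at h
      have := brickSide_pos (sizeClass s - 1)
      rw [h]; gcongr; exact hs.1.le
    rw [totalArea_concat]
    by_cases hL' : L = []
    · subst hL'
      simpa [totalArea, stateOf] using inv_initialState hk
    · rw [stateOf_concat hL']
      exact (ih hL' fun t ht => hpos t (by simp [ht])).use hk

/-- The square placed last lies in a brick that was free before. -/
lemma exists_free_brick {L : List ℝ} (hL : L ≠ []) (hpos : ∀ s ∈ L, 0 < s) {s : ℝ}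
    (hs : 0 < s) : ∃ j ∈ (stateOf L).free,
      interior (placedSq s (brickStrategy (L ++ [s]))) ⊆ openBrick j ((stateOf L).corner j) := by
  obtain ⟨hkj, hj, -⟩ := nextFree_spec ((inv_stateOf hL hpos).exists_ge (sizeClass s))
  refine ⟨_, hj, ?_⟩
  rw [brickStrategy_concat hL]
  exact (interior_placedSq_subset_openBrick (sizeClass_spec hs).2 _).trans (openBrick_mono hkj _)

/-- All placed squares are disjoint from all free bricks. -/
lemma disjoint_free_brick {L : List ℝ} (hpos : ∀ s ∈ L, 0 < s) {l : List ℝ} {s : ℝ}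
    (hl : l ++ [s] <+: L) {i : ℤ} (hi : i ∈ (stateOf L).free) :
    Disjoint (interior (placedSq s (brickStrategy (l ++ [s]))))
      (openBrick i ((stateOf L).corner i)) := by
  induction L using List.reverseRecOn generalizing i with
  | nil => simp at hl
  | append_singleton L t ih =>
    have hposL : ∀ u ∈ L, 0 < u := fun u hu => hpos u (by simp [hu])
    have ht : 0 < t := hpos t (by simp)
    by_cases hL : L = []
    · subst hL
      have hls : l = [] ∧ s = t := by
        rcases List.prefix_concat_iff.1 hl with h | h
        · obtain ⟨h1, h2⟩ := List.append_inj' h rfl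
          exact ⟨h1, List.singleton_inj.1 h2⟩
        · simp at h
      obtain ⟨rfl, rfl⟩ := hls
      have hi' : sizeClass s ≤ i := by simpa [stateOf, initialState] using hi
      simp only [List.nil_append, brickStrategy_singleton]
      exact (disjoint_openBrick_shift hi' 0).mono_left
        (interior_placedSq_subset_openBrick (sizeClass_spec ht).2 0)
    have hS := inv_stateOf hL hposL
    obtain ⟨hkj, hj, hno⟩ := nextFree_spec (hS.exists_ge (sizeClass t))
    rw [stateOf_concat hL] at hi ⊢
    have hcases := BrickState.use_free_cases hi hno
    rcases List.prefix_concat_iff.1 hl with h | h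
    · obtain ⟨rfl, rfl⟩ := List.append_inj' h rfl |>.imp_right List.singleton_inj.1
      rw [brickStrategy_concat hL]
      have hsub := interior_placedSq_subset_openBrick (sizeClass_spec ht).2
        ((stateOf l).corner (nextFree (stateOf l).free (sizeClass s)))
      rcases hcases with ⟨h1, h2, h3⟩ | ⟨h1, h2, h3⟩ <;> rw [h3]
      · exact (disjoint_openBrick_shift h1 _).mono_left hsub
      · refine Disjoint.mono_left (hsub.trans (openBrick_mono hkj _)) ?_
        exact h2.lt_or_gt.elim (fun h => (hS.disjoint i h1 _ hj h).symm)
          fun h => hS.disjoint _ hj i h1 h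
    · rcases hcases with ⟨h1, h2, h3⟩ | ⟨h1, h2, h3⟩ <;> rw [h3]
      · exact (ih hposL h hj).mono_right (openBrick_shift_subset h2 _)
      · exact ih hposL h h1

/-- Each square is placed within a box of area six times the total area so far. -/
lemma brickStrategy_bound {l : List ℝ} (hl : ∀ s ∈ l, 0 < s) {s : ℝ} (hs : 0 < s) :
    (0 ≤ (brickStrategy (l ++ [s])).1 ∧ 0 ≤ (brickStrategy (l ++ [s])).2) ∧
    ((brickStrategy (l ++ [s])).1 + s) ^ 2 ≤ 6 * totalArea (l ++ [s]) ∧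
    ((brickStrategy (l ++ [s])).2 + s) ^ 2 ≤ 6 * totalArea (l ++ [s]) := by
  rw [totalArea_concat]
  have ha := totalArea_nonneg l
  by_cases hL : l = []
  · subst hL
    simp only [List.nil_append, brickStrategy_singleton]
    simp only [Prod.fst_zero, Prod.snd_zero, zero_add, le_refl, true_and]
    constructor <;> nlinarith [sq_nonneg s]
  · have hS := inv_stateOf hL hl
    obtain ⟨hkj, hj, hno⟩ := nextFree_spec (hS.exists_ge (sizeClass s))
    obtain ⟨g, -, hg2, hg3, hg4⟩ := hS.exists_volume
    rw [brickStrategy_concat hL]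
    have hv := hg3 (sizeClass s)
    rw [← eq_of_forall_notMem hg2 hkj hno] at hv
    obtain ⟨h1, h2⟩ := sizeClass_spec hs
    have hn := hS.nonneg _ hj
    exact ⟨hn, (hg4 _ hj).1.sq_le hn.1 hkj h1 h2 ha hv, (hg4 _ hj).2.sq_le hn.2 hkj h1 h2 ha hv⟩

lemma totalArea_mono {l L : List ℝ} (h : l <+: L) : totalArea l ≤ totalArea L := by
  obtain ⟨t, rfl⟩ := h
  have := totalArea_nonneg t
  simp only [totalArea, List.map_append, List.sum_append] at *
  linarith

lemma take_succ_eq (L : List ℝ) (i : Fin L.length) :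
    L.take ((i : ℕ) + 1) = L.take i ++ [L.get i] := by
  simp

lemma sqStrategyValid_brickStrategy : SqStrategyValid brickStrategy := by
  intro L hpos
  have hposT (n : ℕ) : ∀ s ∈ L.take n, 0 < s := fun s hs => hpos s (List.mem_of_mem_take hs)
  have main : ∀ i j : Fin L.length, i < j →
      Disjoint (interior (placedSq (L.get i) (onlineSqPos brickStrategy L i)))
        (interior (placedSq (L.get j) (onlineSqPos brickStrategy L j))) := by
    intro i j hij
    have hij' : (i : ℕ) < j := hij
    have hne : L.take j ≠ [] := by
      rw [Ne, ← List.length_eq_zero_iff, List.length_take]; omega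
    obtain ⟨m, hm, hsub⟩ := exists_free_brick hne (hposT j) (hpos _ (L.get_mem j))
    have hpre : L.take i ++ [L.get i] <+: L.take j := by
      rw [← take_succ_eq]; exact List.take_prefix_take_left hij'
    have := disjoint_free_brick (hposT j) hpre hm
    simp only [onlineSqPos, take_succ_eq]
    exact this.mono_right hsub
  intro i j hij
  exact hij.lt_or_gt.elim (main i j) fun h => (main j i h).symm

/-! ### Costs -/

lemma isCompact_packedSqSet (L : List ℝ) (pos : Fin L.length → ℝ × ℝ) :
    IsCompact (packedSqSet L pos) :=
  isCompact_iUnion fun _ => isCompact_Icc.prod isCompact_Icc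

/-- Points of the packed set lie in its bounding box. -/
lemma mem_packedSqSet_bounds {L : List ℝ} {pos : Fin L.length → ℝ × ℝ} {x : ℝ × ℝ}
    (hx : x ∈ packedSqSet L pos) :
    x.1 ∈ Icc (sInf (Prod.fst '' packedSqSet L pos)) (sSup (Prod.fst '' packedSqSet L pos)) ∧
    x.2 ∈ Icc (sInf (Prod.snd '' packedSqSet L pos)) (sSup (Prod.snd '' packedSqSet L pos)) := by
  have h1 := (isCompact_packedSqSet L pos).image continuous_fst
  have h2 := (isCompact_packedSqSet L pos).image continuous_snd
  exact ⟨⟨csInf_le h1.bddBelow ⟨x, hx, rfl⟩, le_csSup h1.bddAbove ⟨x, hx, rfl⟩⟩,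
    ⟨csInf_le h2.bddBelow ⟨x, hx, rfl⟩, le_csSup h2.bddAbove ⟨x, hx, rfl⟩⟩⟩

lemma packedSqSet_nonempty {L : List ℝ} (hL : L ≠ []) (hpos : ∀ s ∈ L, 0 < s)
    (pos : Fin L.length → ℝ × ℝ) : (packedSqSet L pos).Nonempty := by
  let i : Fin L.length := ⟨0, List.length_pos_of_ne_nil hL⟩
  have := hpos _ (L.get_mem i)
  exact ⟨pos i, mem_iUnion.2 ⟨i, ⟨le_rfl, by linarith⟩, ⟨le_rfl, by linarith⟩⟩⟩

open MeasureTheory in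
lemma totalArea_le_sqCost {L : List ℝ} (hL : L ≠ []) (hpos : ∀ s ∈ L, 0 < s)
    {pos : Fin L.length → ℝ × ℝ} (h : IsSqPacking L pos) : totalArea L ≤ sqCost L pos := by
  obtain ⟨x, hx⟩ := packedSqSet_nonempty hL hpos pos
  obtain ⟨⟨h1, h2⟩, ⟨h3, h4⟩⟩ := mem_packedSqSet_bounds hx
  have hw : 0 ≤ boxWidth (packedSqSet L pos) := by unfold boxWidth; linarith
  have hh : 0 ≤ boxHeight (packedSqSet L pos) := by unfold boxHeight; linarith
  have hvol (i : Fin L.length) :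
      volume (interior (placedSq (L.get i) (pos i))) = ENNReal.ofReal (L.get i ^ 2) := by
    rw [interior_placedSq, Measure.volume_eq_prod, Measure.prod_prod, Real.volume_Ioo,
      Real.volume_Ioo, add_sub_cancel_left, add_sub_cancel_left, ← ENNReal.ofReal_mul
      (hpos _ (L.get_mem i)).le, sq]
  have hsum : totalArea L = ∑ i : Fin L.length, L.get i ^ 2 := by
    rw [totalArea, ← List.sum_ofFn]
    congr 1
    conv_lhs => rw [← List.ofFn_get L]
    rw [List.map_ofFn]
    rfl
  have key : ENNReal.ofReal (totalArea L) ≤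
      ENNReal.ofReal (boxWidth (packedSqSet L pos) * boxHeight (packedSqSet L pos)) := by
    calc ENNReal.ofReal (totalArea L)
        = ∑ i : Fin L.length, volume (interior (placedSq (L.get i) (pos i))) := by
          rw [hsum, ENNReal.ofReal_sum_of_nonneg fun i _ => sq_nonneg _]
          exact Finset.sum_congr rfl fun i _ => (hvol i).symm
      _ = volume (⋃ i, interior (placedSq (L.get i) (pos i))) := by
          rw [measure_iUnion (fun i j hij => h i j hij) fun i => isOpen_interior.measurableSet,
            tsum_fintype]
      _ ≤ volume (Icc (sInf (Prod.fst '' packedSqSet L pos))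
            (sSup (Prod.fst '' packedSqSet L pos)) ×ˢ
          Icc (sInf (Prod.snd '' packedSqSet L pos)) (sSup (Prod.snd '' packedSqSet L pos))) :=
          measure_mono <| iUnion_subset fun i x hx =>
            mem_packedSqSet_bounds (mem_iUnion.2 ⟨i, interior_subset hx⟩)
      _ = _ := by
          rw [Measure.volume_eq_prod, Measure.prod_prod, Real.volume_Icc, Real.volume_Icc,
            ← ENNReal.ofReal_mul (by linarith)]
          rfl
  rw [ENNReal.ofReal_le_ofReal_iff (mul_nonneg hw hh)] at key
  refine key.trans ?_
  rw [sqCost, sq]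
  gcongr
  exacts [le_max_left _ _, le_max_right _ _]

lemma sqCost_le {L : List ℝ} (hL : L ≠ []) (hpos : ∀ s ∈ L, 0 < s)
    {pos : Fin L.length → ℝ × ℝ} {m : ℝ}
    (h : ∀ i, (0 ≤ (pos i).1 ∧ 0 ≤ (pos i).2) ∧
      (pos i).1 + L.get i ≤ m ∧ (pos i).2 + L.get i ≤ m) : sqCost L pos ≤ m ^ 2 := by
  have hne := packedSqSet_nonempty hL hpos pos
  have hmem : ∀ x ∈ packedSqSet L pos, (0 ≤ x.1 ∧ x.1 ≤ m) ∧ (0 ≤ x.2 ∧ x.2 ≤ m) := by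
    intro x hx
    obtain ⟨i, ⟨⟨h1, h2⟩, ⟨h3, h4⟩⟩⟩ := mem_iUnion.1 hx
    obtain ⟨⟨h5, h6⟩, h7, h8⟩ := h i
    exact ⟨⟨h5.trans h1, h2.trans h7⟩, ⟨h6.trans h3, h4.trans h8⟩⟩
  have ⟨x, hx⟩ := hne
  obtain ⟨⟨b1, b2⟩, -⟩ := mem_packedSqSet_bounds hx
  have i1 : 0 ≤ sInf (Prod.fst '' packedSqSet L pos) :=
    le_csInf (hne.image _) (by rintro _ ⟨y, hy, rfl⟩; exact (hmem y hy).1.1)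
  have i2 : 0 ≤ sInf (Prod.snd '' packedSqSet L pos) :=
    le_csInf (hne.image _) (by rintro _ ⟨y, hy, rfl⟩; exact (hmem y hy).2.1)
  have s1 : sSup (Prod.fst '' packedSqSet L pos) ≤ m :=
    csSup_le (hne.image _) (by rintro _ ⟨y, hy, rfl⟩; exact (hmem y hy).1.2)
  have s2 : sSup (Prod.snd '' packedSqSet L pos) ≤ m :=
    csSup_le (hne.image _) (by rintro _ ⟨y, hy, rfl⟩; exact (hmem y hy).2.2)
  refine pow_le_pow_left₀ (le_max_of_le_left ?_) (max_le ?_ ?_) 2 <;>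
    simp only [boxWidth, boxHeight] <;> linarith

/-- There exists a valid online translation strategy `σ` for
streams of square pieces such that for every nonempty finite stream `L` of
square pieces, `ALG_σ(L) ≤ 6 * OPT(L)` (area of the smallest axis-parallel
bounding square). -/
theorem square_in_square_six_competitive :
    ∃ σ : List ℝ → ℝ × ℝ, SqStrategyValid σ ∧
      ∀ L : List ℝ, L ≠ [] → (∀ s ∈ L, 0 < s) →
        algSq σ L ≤ 6 * optSq L := by
  refine ⟨brickStrategy, sqStrategyValid_brickStrategy, fun L hL hpos => ?_⟩
  have hopt : totalArea L ≤ optSq L :=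
    le_csInf ⟨_, _, sqStrategyValid_brickStrategy L hpos, rfl⟩
      (by rintro _ ⟨pos, hpack, rfl⟩; exact totalArea_le_sqCost hL hpos hpack)
  have hbound : algSq brickStrategy L ≤ √(6 * totalArea L) ^ 2 := by
    refine sqCost_le hL hpos fun i => ?_
    obtain ⟨h0, h1, h2⟩ := brickStrategy_bound (l := L.take i)
      (fun s hs => hpos s (List.mem_of_mem_take hs)) (hpos _ (L.get_mem i))
    rw [← take_succ_eq] at h0 h1 h2
    have hm := totalArea_mono (List.take_prefix ((i : ℕ) + 1) L)
    exact ⟨h0, Real.le_sqrt_of_sq_le (h1.trans (by linarith)),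
      Real.le_sqrt_of_sq_le (h2.trans (by linarith))⟩
  rw [Real.sq_sqrt (by linarith [totalArea_nonneg L])] at hbound
  linarith
end

section
/- Suppose an axis-parallel closed square of side length 2 and four axis-parallel closed squares of side length 1 have pairwise disjoint interiors and are all contained in an axis-parallel closed square of side length s, and suppose moreover that the four unit squares are all contained in some axis-parallel closed square of side length strictly less than 3. Then s ≥ 4. -/
open Set

/-- A nondegenerate square contained in another one: coordinate inequalities. -/
lemma placedSq_subset_bounds {r s : ℝ} (hr : 0 ≤ r) {p q : ℝ × ℝ}
    (h : placedSq r p ⊆ placedSq s q) :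
    (q.1 ≤ p.1 ∧ p.1 + r ≤ q.1 + s) ∧ (q.2 ≤ p.2 ∧ p.2 + r ≤ q.2 + s) := by
  have h1 : p ∈ placedSq s q := h (by simp [placedSq, Prod.le_def, hr])
  have h2 : (p.1 + r, p.2 + r) ∈ placedSq s q := h (by simp [placedSq, Prod.le_def, hr])
  simp only [placedSq, Set.mem_prod, Set.mem_Icc] at h1 h2
  exact ⟨⟨h1.1.1, h2.1.2⟩, h1.2.1, h2.2.2⟩

/-- Squares with disjoint interiors are separated in one of the coordinates. -/
lemma separated_of_disjoint_interior {r s : ℝ} (hr : 0 < r) (hs : 0 < s) {p q : ℝ × ℝ}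
    (h : Disjoint (interior (placedSq r p)) (interior (placedSq s q))) :
    p.1 + r ≤ q.1 ∨ q.1 + s ≤ p.1 ∨ p.2 + r ≤ q.2 ∨ q.2 + s ≤ p.2 := by
  by_contra! hc
  obtain ⟨h1, h2, h3, h4⟩ := hc
  simp only [placedSq, interior_prod_eq, interior_Icc] at h
  obtain ⟨x, hx1, hx2⟩ := exists_between
    (show max p.1 q.1 < min (p.1 + r) (q.1 + s) by simp [*])
  obtain ⟨y, hy1, hy2⟩ := exists_between
    (show max p.2 q.2 < min (p.2 + r) (q.2 + s) by simp [*])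
  rw [max_lt_iff] at hx1 hy1
  rw [lt_min_iff] at hx2 hy2
  exact Set.disjoint_left.mp h (show (x, y) ∈ _ from
    ⟨⟨hx1.1, hx2.1⟩, hy1.1, hy2.1⟩) ⟨⟨hx1.2, hx2.2⟩, hy1.2, hy2.2⟩

/-- If a closed square of side 2 and four closed unit squares
have pairwise disjoint interiors and all lie in a closed square of side `s`,
and the four unit squares all lie in some closed square of side strictly less
than 3, then `s ≥ 4`. -/
theorem two_by_two_and_four_units_need_side_four
    (s t : ℝ) (ht : t < 3) (c d a : ℝ × ℝ) (b : Fin 4 → ℝ × ℝ)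
    (hdisj0 : ∀ i : Fin 4,
      Disjoint (interior (placedSq 2 a)) (interior (placedSq 1 (b i))))
    (hdisj : ∀ i j : Fin 4, i ≠ j →
      Disjoint (interior (placedSq 1 (b i))) (interior (placedSq 1 (b j))))
    (hbig : placedSq 2 a ⊆ placedSq s c)
    (hunits : ∀ i : Fin 4, placedSq 1 (b i) ⊆ placedSq s c)
    (hsmall : ∀ i : Fin 4, placedSq 1 (b i) ⊆ placedSq t d) :
    4 ≤ s := by
  have hA := placedSq_subset_bounds zero_le_two hbig
  have hU := fun i => placedSq_subset_bounds zero_le_one (hunits i)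
  have hS := fun i => placedSq_subset_bounds zero_le_one (hsmall i)
  have hsep0 := fun i => separated_of_disjoint_interior two_pos one_pos (hdisj0 i)
  have hsep := fun i j hij => separated_of_disjoint_interior one_pos one_pos (hdisj i j hij)
  -- The four unit squares occupy the four quadrants of the small square.
  let f : Fin 4 → Prop × Prop := fun i => ((b i).1 < d.1 + 1, (b i).2 < d.2 + 1)
  have hinj : Function.Injective f := by
    intro i j hij
    by_contra hne
    obtain ⟨hx, hy⟩ : ((b i).1 < d.1 + 1 ↔ (b j).1 < d.1 + 1) ∧
        ((b i).2 < d.2 + 1 ↔ (b j).2 < d.2 + 1) := by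
      simpa [f] using hij
    obtain ⟨⟨_, _⟩, _, _⟩ := hS i
    obtain ⟨⟨_, _⟩, _, _⟩ := hS j
    rcases hsep i j hne with h | h | h | h
    · exact absurd (hx.1 (by linarith)) (by linarith)
    · exact absurd (hx.2 (by linarith)) (by linarith)
    · exact absurd (hy.1 (by linarith)) (by linarith)
    · exact absurd (hy.2 (by linarith)) (by linarith)
  have hsurj : Function.Surjective f :=
    ((Fintype.bijective_iff_injective_and_card f).2 ⟨hinj, by simp⟩).2
  obtain ⟨i, hi⟩ := hsurj (True, True)
  obtain ⟨j, hj⟩ := hsurj (False, True)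
  obtain ⟨k, hk⟩ := hsurj (True, False)
  obtain ⟨l, hl⟩ := hsurj (False, False)
  simp only [f, Prod.mk.injEq, eq_iff_iff, iff_true, iff_false, not_lt] at hi hj hk hl
  obtain ⟨hi1, hi2⟩ := hi
  obtain ⟨hj1, hj2⟩ := hj
  obtain ⟨hk1, hk2⟩ := hk
  obtain ⟨hl1, hl2⟩ := hl
  obtain ⟨⟨_, _⟩, _, _⟩ := hA
  obtain ⟨⟨_, _⟩, _, _⟩ := hU i
  obtain ⟨⟨_, _⟩, _, _⟩ := hU j
  obtain ⟨⟨_, _⟩, _, _⟩ := hU k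
  obtain ⟨⟨_, _⟩, _, _⟩ := hU l
  obtain ⟨⟨_, _⟩, _, _⟩ := hS i
  obtain ⟨⟨_, _⟩, _, _⟩ := hS j
  obtain ⟨⟨_, _⟩, _, _⟩ := hS k
  obtain ⟨⟨_, _⟩, _, _⟩ := hS l
  have hij : (b i).1 + 1 ≤ (b j).1 := by
    rcases hsep i j (by rintro rfl; linarith) with h | h | h | h <;> linarith
  have hkl : (b k).1 + 1 ≤ (b l).1 := by
    rcases hsep k l (by rintro rfl; linarith) with h | h | h | h <;> linarith
  have hik : (b i).2 + 1 ≤ (b k).2 := by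
    rcases hsep i k (by rintro rfl; linarith) with h | h | h | h <;> linarith
  have hjl : (b j).2 + 1 ≤ (b l).2 := by
    rcases hsep j l (by rintro rfl; linarith) with h | h | h | h <;> linarith
  by_contra! hs
  have hi' : (b i).1 + 1 ≤ a.1 ∨ (b i).2 + 1 ≤ a.2 := by
    rcases hsep0 i with h | h | h | h
    exacts [by linarith, .inl h, by linarith, .inr h]
  have hj' : a.1 + 2 ≤ (b j).1 ∨ (b j).2 + 1 ≤ a.2 := by
    rcases hsep0 j with h | h | h | h
    exacts [.inl h, by linarith, by linarith, .inr h]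
  have hk' : (b k).1 + 1 ≤ a.1 ∨ a.2 + 2 ≤ (b k).2 := by
    rcases hsep0 k with h | h | h | h
    exacts [by linarith, .inl h, .inr h, by linarith]
  have hl' : a.1 + 2 ≤ (b l).1 ∨ a.2 + 2 ≤ (b l).2 := by
    rcases hsep0 l with h | h | h | h
    exacts [.inl h, by linarith, .inr h, by linarith]
  rcases hi' with _ | _ <;> rcases hj' with _ | _ <;> rcases hk' with _ | _ <;>
    rcases hl' with _ | _ <;> linarith
end
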